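/- arXiv:2401.08531 — 7 statements merged into one kernel-verified Lean document; each statement's English description precedes it below -/
import Mathlib

section
/- Let u₀ : [0,∞) → ℂ be smooth and, together with all of its derivatives, decay faster than any negative power of x as x → +∞ (e.g., the restriction to [0,∞) of a Schwartz function on ℝ). Define û₀(λ) := ∫₀^∞ e^{−iλy} u₀(y) dy for λ ∈ ℝ and F(x,t) := ∫_{−∞}^{∞} e^{iλx − λ²t} û₀(λ) dλ for (x,t) ∈ Q (absolutely convergent for t > 0 since û₀(λ) = O(1/|λ|)). Then F is smooth on Q, and for all nonnegative integers k, m, ℓ and every T₀ > 0, x^ℓ · ∂^{k+m} F/∂x^k ∂t^m (x,t) → 0 as x → +∞, uniformly for 0 < t ≤ T₀. -/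
open MeasureTheory Filter Set Topology

/-- The half-line Fourier transform `û₀(λ) = ∫₀^∞ e^{−iλy} u₀(y) dy` for real `λ`. -/
noncomputable def uhatHeat (u₀ : ℝ → ℂ) (l : ℝ) : ℂ :=
  ∫ y in Ioi (0:ℝ), Complex.exp (-(Complex.I * (l:ℂ) * (y:ℂ))) * u₀ y

/-- The initial-data term `F(x,t) = ∫_{−∞}^{∞} e^{iλx − λ²t} û₀(λ) dλ`. -/
noncomputable def FHeat (u₀ : ℝ → ℂ) (x t : ℝ) : ℂ :=
  ∫ l : ℝ, Complex.exp (Complex.I * (l:ℂ) * (x:ℂ) - (l:ℂ)^2 * (t:ℂ)) * uhatHeat u₀ l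


/-- Bounded measurable weight. -/
def GoodW (w : ℝ → ℂ) : Prop := AEStronglyMeasurable w volume ∧ ∃ M : ℝ, ∀ l, ‖w l‖ ≤ M

noncomputable def GH (w : ℝ → ℂ) (n : ℕ) (x t : ℝ) : ℂ :=
  ∫ l : ℝ, (Complex.I * (l:ℂ)) ^ n *
    Complex.exp (Complex.I * (l:ℂ) * (x:ℂ) - (l:ℂ)^2 * (t:ℂ)) * w l

lemma norm_kernel (l x t : ℝ) :
    ‖Complex.exp (Complex.I * (l:ℂ) * (x:ℂ) - (l:ℂ)^2 * (t:ℂ))‖ = Real.exp (-t * l ^ 2) := by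
  rw [Complex.norm_exp]
  congr 1
  simp [← Complex.ofReal_pow]
  ring

lemma integrable_abs_pow_gauss (n : ℕ) {t : ℝ} (ht : 0 < t) :
    Integrable (fun l : ℝ => |l| ^ n * Real.exp (-t * l ^ 2)) := by
  have h := (integrable_rpow_mul_exp_neg_mul_sq (b := t) ht (s := (n:ℝ)) (by
    have : (0:ℝ) ≤ n := Nat.cast_nonneg n
    linarith)).norm
  refine h.congr (Eventually.of_forall fun l => ?_)
  simp [abs_of_pos (Real.exp_pos _)]

lemma meas_GH {w : ℝ → ℂ} (hw : GoodW w) (n : ℕ) (x t : ℝ) :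
    AEStronglyMeasurable (fun l : ℝ => (Complex.I * (l:ℂ)) ^ n *
    Complex.exp (Complex.I * (l:ℂ) * (x:ℂ) - (l:ℂ)^2 * (t:ℂ)) * w l) volume := by
  refine AEStronglyMeasurable.mul (Continuous.aestronglyMeasurable (by fun_prop)) hw.1

lemma integrable_GH {w : ℝ → ℂ} (hw : GoodW w) (n : ℕ) (x : ℝ) {t : ℝ} (ht : 0 < t) :
    Integrable (fun l : ℝ => (Complex.I * (l:ℂ)) ^ n *
    Complex.exp (Complex.I * (l:ℂ) * (x:ℂ) - (l:ℂ)^2 * (t:ℂ)) * w l) := by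
  obtain ⟨M, hM⟩ := hw.2
  refine ((integrable_abs_pow_gauss n ht).mul_const M).mono' (meas_GH hw n x t)
    (Eventually.of_forall fun l => ?_)
  rw [norm_mul, norm_mul, norm_kernel]
  simp only [norm_pow, norm_mul, Complex.norm_I, one_mul, Complex.norm_real, Real.norm_eq_abs]
  gcongr
  exact hM l

noncomputable def LH (a b : ℂ) : ℝ × ℝ →L[ℝ] ℂ :=
  (ContinuousLinearMap.fst ℝ ℝ ℝ).smulRight a + (ContinuousLinearMap.snd ℝ ℝ ℝ).smulRight b

lemma LH_apply (a b : ℂ) (p : ℝ × ℝ) : LH a b p = p.1 • a + p.2 • b := rfl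

lemma LH_norm (a b : ℂ) : ‖LH a b‖ ≤ ‖a‖ + ‖b‖ := by
  refine ContinuousLinearMap.opNorm_le_bound _ (by positivity) fun p => ?_
  rw [LH_apply]
  refine (norm_add_le _ _).trans ?_
  rw [norm_smul, norm_smul, add_mul, mul_comm ‖a‖, mul_comm ‖b‖]
  gcongr
  · exact norm_fst_le p
  · exact norm_snd_le p

lemma LH_eq (a b : ℂ) : LH a b =
    (ContinuousLinearMap.smulRightL ℝ (ℝ × ℝ) ℂ (ContinuousLinearMap.fst ℝ ℝ ℝ)) a +
    (ContinuousLinearMap.smulRightL ℝ (ℝ × ℝ) ℂ (ContinuousLinearMap.snd ℝ ℝ ℝ)) b := rfl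

lemma hasFDerivAt_GH {w : ℝ → ℂ} (hw : GoodW w) (n : ℕ) (x : ℝ) {t : ℝ} (ht : 0 < t) :
    HasFDerivAt (fun p : ℝ × ℝ => GH w n p.1 p.2)
      (LH (GH w (n+1) x t) (GH w (n+2) x t)) (x, t) := by
  obtain ⟨M, hM⟩ := hw.2
  have key := hasFDerivAt_integral_of_dominated_of_fderiv_le (𝕜 := ℝ) (μ := (volume : Measure ℝ))
    (x₀ := (x, t)) (s := {p : ℝ × ℝ | t / 2 < p.2})
    (F := fun (p : ℝ × ℝ) (l : ℝ) => (Complex.I * (l:ℂ)) ^ n *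
      Complex.exp (Complex.I * (l:ℂ) * (p.1:ℂ) - (l:ℂ)^2 * (p.2:ℂ)) * w l)
    (F' := fun (p : ℝ × ℝ) (l : ℝ) =>
      LH ((Complex.I * (l:ℂ)) ^ (n+1) *
        Complex.exp (Complex.I * (l:ℂ) * (p.1:ℂ) - (l:ℂ)^2 * (p.2:ℂ)) * w l)
        ((Complex.I * (l:ℂ)) ^ (n+2) *
        Complex.exp (Complex.I * (l:ℂ) * (p.1:ℂ) - (l:ℂ)^2 * (p.2:ℂ)) * w l))
    (bound := fun l => |l| ^ (n+1) * Real.exp (-(t/2) * l ^ 2) * M +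
      |l| ^ (n+2) * Real.exp (-(t/2) * l ^ 2) * M)
    ((isOpen_lt continuous_const continuous_snd).mem_nhds (by simp; linarith))
    (Eventually.of_forall fun p => meas_GH hw n p.1 p.2)
    (integrable_GH hw n x ht) ?_ ?_ ?_ ?_
  · have e : (∫ l : ℝ, LH ((Complex.I * (l:ℂ)) ^ (n+1) *
        Complex.exp (Complex.I * (l:ℂ) * (x:ℂ) - (l:ℂ)^2 * (t:ℂ)) * w l)
        ((Complex.I * (l:ℂ)) ^ (n+2) *
        Complex.exp (Complex.I * (l:ℂ) * (x:ℂ) - (l:ℂ)^2 * (t:ℂ)) * w l)) =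
        LH (GH w (n+1) x t) (GH w (n+2) x t) := by
      simp only [LH_eq]
      rw [integral_add, ContinuousLinearMap.integral_comp_comm, ContinuousLinearMap.integral_comp_comm]
      · rfl
      · exact integrable_GH hw _ x ht
      · exact integrable_GH hw _ x ht
      · exact ContinuousLinearMap.integrable_comp _ (integrable_GH hw _ x ht)
      · exact ContinuousLinearMap.integrable_comp _ (integrable_GH hw _ x ht)
    rw [← e]
    exact key
  · simp only [LH_eq]
    exact (ContinuousLinearMap.continuous _).comp_aestronglyMeasurable (meas_GH hw _ x t) |>.add
      ((ContinuousLinearMap.continuous _).comp_aestronglyMeasurable (meas_GH hw _ x t))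
  · refine Eventually.of_forall fun l p hp => (LH_norm _ _).trans ?_
    have hp : t / 2 < p.2 := hp
    simp only [norm_mul, norm_kernel]
    simp only [norm_pow, norm_mul, Complex.norm_I, one_mul, Complex.norm_real, Real.norm_eq_abs]
    gcongr
    all_goals exact hM l
  · exact ((integrable_abs_pow_gauss _ (half_pos ht)).mul_const M).add
      ((integrable_abs_pow_gauss _ (half_pos ht)).mul_const M)
  · refine Eventually.of_forall fun l p hp => ?_
    have h1 : HasFDerivAt (fun p : ℝ × ℝ =>
        Complex.I * (l:ℂ) * (p.1:ℂ) - (l:ℂ)^2 * (p.2:ℂ))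
        (LH (Complex.I * (l:ℂ)) (-(l:ℂ)^2)) p := by
      have := (LH (Complex.I * (l:ℂ)) (-(l:ℂ)^2)).hasFDerivAt (x := p)
      refine this.congr_of_eventuallyEq (Eventually.of_forall fun q => ?_)
      simp only [LH_apply, Complex.real_smul]
      ring
    have h2 := ((h1.cexp).const_mul ((Complex.I * (l:ℂ)) ^ n)).mul_const (w l)
    refine h2.congr_fderiv ?_
    ext <;> simp [LH_apply] <;> ring_nf <;> simp

lemma hasDerivAt_GH_x {w : ℝ → ℂ} (hw : GoodW w) (n : ℕ) (x : ℝ) {t : ℝ} (ht : 0 < t) :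
    HasDerivAt (fun y => GH w n y t) (GH w (n+1) x t) x := by
  have h := (hasFDerivAt_GH hw n x ht).comp_hasDerivAt x
    ((hasDerivAt_id x).prodMk (hasDerivAt_const x t))
  simp only [LH_apply, one_smul, zero_smul, add_zero, zero_add] at h
  exact h

lemma hasDerivAt_GH_t {w : ℝ → ℂ} (hw : GoodW w) (n : ℕ) (x : ℝ) {t : ℝ} (ht : 0 < t) :
    HasDerivAt (fun s => GH w n x s) (GH w (n+2) x t) t := by
  have h := (hasFDerivAt_GH hw n x ht).comp_hasDerivAt t
    ((hasDerivAt_const t x).prodMk (hasDerivAt_id t))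
  simp only [LH_apply, one_smul, zero_smul, add_zero, zero_add] at h
  exact h

lemma contDiffOn_GH {w : ℝ → ℂ} (hw : GoodW w) (N : ℕ) : ∀ n,
    ContDiffOn ℝ N (fun p : ℝ × ℝ => GH w n p.1 p.2) (univ ×ˢ Ioi (0:ℝ)) := by
  have ho : IsOpen ((univ : Set ℝ) ×ˢ Ioi (0:ℝ)) := isOpen_univ.prod isOpen_Ioi
  induction N with
  | zero =>
    intro n
    refine contDiffOn_zero.2 fun p hp => ?_
    exact (hasFDerivAt_GH hw n p.1 hp.2).continuousAt.continuousWithinAt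
  | succ N ih =>
    intro n
    push_cast
    rw [contDiffOn_succ_iff_hasFDerivWithinAt_of_uniqueDiffOn ho.uniqueDiffOn]
    refine ⟨by simp, fun p => LH (GH w (n+1) p.1 p.2) (GH w (n+2) p.1 p.2), ?_, fun p hp =>
      (hasFDerivAt_GH hw n p.1 hp.2).hasFDerivWithinAt⟩
    simp only [LH_eq]
    exact ((ContinuousLinearMap.contDiff _).comp_contDiffOn (ih _)).add
      ((ContinuousLinearMap.contDiff _).comp_contDiffOn (ih _))

lemma iteratedDeriv_GH_t {w : ℝ → ℂ} (hw : GoodW w) (m n : ℕ) (x : ℝ) :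
    ∀ t : ℝ, 0 < t → iteratedDeriv m (fun s => GH w n x s) t = GH w (n + 2 * m) x t := by
  induction m with
  | zero => intro t ht; simp
  | succ m ih =>
    intro t ht
    rw [iteratedDeriv_succ]
    have : iteratedDeriv m (fun s => GH w n x s) =ᶠ[𝓝 t] fun s => GH w (n + 2 * m) x s := by
      filter_upwards [Ioi_mem_nhds ht] with s hs using ih s hs
    rw [this.deriv_eq, (hasDerivAt_GH_t hw _ x ht).deriv]
    congr 1

lemma iteratedDeriv_GH_x {w : ℝ → ℂ} (hw : GoodW w) (k n : ℕ) {t : ℝ} (ht : 0 < t) :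
    iteratedDeriv k (fun y => GH w n y t) = fun y => GH w (n + k) y t := by
  induction k with
  | zero => simp
  | succ k ih =>
    rw [iteratedDeriv_succ, ih]
    funext y
    rw [(hasDerivAt_GH_x hw _ y ht).deriv]
    congr 1

lemma goodOne : GoodW (fun _ => 1) := ⟨aestronglyMeasurable_const, 1, by simp⟩

lemma K0_eq (x : ℝ) {t : ℝ} (ht : 0 < t) : GH (fun _ => 1) 0 x t =
    ((Real.pi / t : ℂ)) ^ (1/2 : ℂ) * Complex.exp (-(x:ℂ)^2 / (4 * t)) := by
  rw [← fourierIntegral_gaussian (b := (t:ℂ)) (by simpa using ht)]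
  unfold GH
  congr 1
  funext l
  rw [← Complex.exp_add]
  simp only [pow_zero, one_mul, mul_one]
  congr 1
  ring

lemma K0_norm (x : ℝ) {t : ℝ} (ht : 0 < t) : ‖GH (fun _ => 1) 0 x t‖ =
    √(Real.pi / t) * Real.exp (-x^2 / (4 * t)) := by
  rw [K0_eq x ht, norm_mul, Complex.norm_exp]
  congr 1
  · rw [← Complex.ofReal_div, Complex.norm_cpow_eq_rpow_re_of_pos (by positivity), Real.sqrt_eq_rpow]
    norm_num
  · congr 1
    rw [show (-(x:ℂ)^2 / (4 * t)) = ((-x^2/(4*t) : ℝ) : ℂ) by push_cast; ring, Complex.ofReal_re]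

lemma K_rec0 (x : ℝ) {t : ℝ} (ht : 0 < t) :
    2 * (t:ℂ) * GH (fun _ => 1) 1 x t + (x:ℂ) * GH (fun _ => 1) 0 x t = 0 := by
  have htc : (t:ℂ) ≠ 0 := by exact_mod_cast ht.ne'
  have h1 := hasDerivAt_GH_x goodOne 0 x ht
  have h2 : HasDerivAt (fun y => GH (fun _ => 1) 0 y t)
      ((((Real.pi / t : ℂ)) ^ (1/2 : ℂ)) *
        (Complex.exp (-(x:ℂ)^2 / (4 * t)) * (-(2 * (x:ℂ)) / (4 * t)))) x := by
    have e : (fun y : ℝ => GH (fun _ => 1) 0 y t) = fun y : ℝ =>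
      ((Real.pi / t : ℂ)) ^ (1/2 : ℂ) * Complex.exp (-(y:ℂ)^2 / (4 * t)) := by
      funext y; exact K0_eq y ht
    rw [e]
    refine HasDerivAt.const_mul _ (HasDerivAt.cexp ?_)
    have h3 : HasDerivAt (fun z : ℂ => -z^2 / (4 * t)) (-(2 * (x:ℂ)) / (4 * t)) (x:ℂ) := by
      have := ((hasDerivAt_pow 2 (x:ℂ)).neg).div_const (4 * (t:ℂ))
      simpa using this
    exact h3.comp_ofReal
  have h3 : GH (fun _ => 1) 1 x t = _ := h1.unique h2
  rw [h3, K0_eq x ht]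
  field_simp
  ring

lemma K_rec (n : ℕ) {t : ℝ} (ht : 0 < t) : ∀ x : ℝ,
    2 * (t:ℂ) * GH (fun _ => 1) (n+2) x t + (x:ℂ) * GH (fun _ => 1) (n+1) x t
      + ((n:ℂ)+1) * GH (fun _ => 1) n x t = 0 := by
  have hid : ∀ x : ℝ, HasDerivAt (fun y : ℝ => (y:ℂ)) 1 x := fun x =>
    (hasDerivAt_id x).ofReal_comp
  induction n with
  | zero =>
    intro x
    have h1 := ((hasDerivAt_GH_x goodOne 1 x ht).const_mul (2 * (t:ℂ))).add
      ((hid x).mul (hasDerivAt_GH_x goodOne 0 x ht))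
    have h2 : HasDerivAt (fun _ : ℝ => (0:ℂ)) 0 x := hasDerivAt_const _ _
    have h3 := h1.unique (h2.congr_of_eventuallyEq
      (Eventually.of_forall fun y => by simpa using K_rec0 y ht))
    rw [← h3]
    simp only [Nat.cast_zero, zero_add, Nat.reduceAdd]
    ring
  | succ n ih =>
    intro x
    have h1 := (((hasDerivAt_GH_x goodOne (n+2) x ht).const_mul (2 * (t:ℂ))).add
      ((hid x).mul (hasDerivAt_GH_x goodOne (n+1) x ht))).add
      ((hasDerivAt_GH_x goodOne n x ht).const_mul ((n:ℂ)+1))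
    have h2 : HasDerivAt (fun _ : ℝ => (0:ℂ)) 0 x := hasDerivAt_const _ _
    have h3 := h1.unique (h2.congr_of_eventuallyEq
      (Eventually.of_forall fun y => by simpa using ih y))
    rw [← h3]
    push_cast
    ring

lemma exp_neg_le_pow {s : ℝ} (hs : 0 < s) (N : ℕ) :
    Real.exp (-s) ≤ (N.factorial : ℝ) / s ^ N := by
  have h := Real.pow_div_factorial_le_exp s hs.le N
  have hf : (0:ℝ) < N.factorial := by exact_mod_cast N.factorial_pos
  rw [Real.exp_neg, le_div_iff₀ (by positivity), inv_mul_le_iff₀ (Real.exp_pos _)]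
  rwa [div_le_iff₀ hf] at h

def KB (n : ℕ) : Prop := ∀ (a l : ℕ) (T : ℝ), 0 < T → ∃ C : ℝ, 0 ≤ C ∧ ∀ x ≥ (1:ℝ),
  ∀ t ∈ Ioc (0:ℝ) T, x ^ l * ‖GH (fun _ => 1) n x t‖ ≤ C * t ^ a

lemma KB0 : KB 0 := by
  intro a l T hT
  set N := a + 1 + l with hN
  refine ⟨(T + Real.pi) * (N.factorial * 4 ^ N) * T ^ l, by positivity, fun x hx t ht => ?_⟩
  have ht0 := ht.1
  have hx0 : 0 < x := by linarith
  rw [K0_norm x ht0]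
  have h1 : √(Real.pi / t) ≤ (T + Real.pi) / t := by
    rw [Real.sqrt_le_left (by positivity), div_pow, div_le_div_iff₀ ht0 (by positivity)]
    have := ht.2
    have hpi := Real.pi_pos
    have : Real.pi * t ≤ (T + Real.pi)^2 := by nlinarith
    nlinarith
  have h2 : Real.exp (-x^2 / (4 * t)) ≤ N.factorial / (x^2/(4*t)) ^ N := by
    rw [neg_div]
    exact exp_neg_le_pow (by positivity) N
  have h3 : x ^ l ≤ (x ^ 2) ^ N := by
    rw [← pow_mul]
    exact pow_le_pow_right₀ hx (by omega)
  have h4 : t ^ l ≤ T ^ l := pow_le_pow_left₀ ht0.le ht.2 l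
  calc x ^ l * (√(Real.pi / t) * Real.exp (-x^2 / (4 * t)))
      ≤ (x^2) ^ N * ((T + Real.pi) / t * (N.factorial / (x^2/(4*t)) ^ N)) := by gcongr
    _ = (T + Real.pi) * (N.factorial * 4 ^ N) * t ^ l * t ^ a := by
      rw [div_pow, mul_pow]
      have : t ^ N = t ^ a * t * t ^ l := by rw [hN]; ring
      rw [this]
      field_simp
    _ ≤ _ := by gcongr

lemma KB1 : KB 1 := by
  intro a l T hT
  obtain ⟨C, hC0, hC⟩ := KB0 (a+1) (l+1) T hT
  refine ⟨C, hC0, fun x hx t ht => ?_⟩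
  have ht0 := ht.1
  have hx0 : 0 < x := by linarith
  have h := hC x hx t ht
  have hr : ‖2 * (t:ℂ) * GH (fun _ => 1) 1 x t‖ = ‖(x:ℂ) * GH (fun _ => 1) 0 x t‖ := by
    rw [eq_neg_of_add_eq_zero_left (K_rec0 x ht0), norm_neg]
  simp only [norm_mul, Complex.norm_real, Real.norm_eq_abs, abs_of_pos ht0, abs_of_pos hx0,
    Complex.norm_ofNat] at hr
  have : t * (x ^ l * ‖GH (fun _ => 1) 1 x t‖) ≤ t * (C * t ^ a) := by
    have e : x ^ (l+1) * ‖GH (fun _ => 1) 0 x t‖ = 2 * (t * (x ^ l * ‖GH (fun _ => 1) 1 x t‖)) := by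
      rw [pow_succ, mul_assoc, ← hr]; ring
    have : 0 ≤ t * (x ^ l * ‖GH (fun _ => 1) 1 x t‖) := by positivity
    have e2 : t ^ (a+1) = t ^ a * t := pow_succ _ _
    rw [e, e2] at h
    linarith
  exact le_of_mul_le_mul_left this ht0

lemma KB_step (n : ℕ) (h0 : KB n) (h1 : KB (n+1)) : KB (n+2) := by
  intro a l T hT
  obtain ⟨C, hC0, hC⟩ := h0 (a+1) l T hT
  obtain ⟨D, hD0, hD⟩ := h1 (a+1) (l+1) T hT
  refine ⟨D + (n+1) * C, by positivity, fun x hx t ht => ?_⟩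
  have ht0 := ht.1
  have hx0 : 0 < x := by linarith
  have hc := hC x hx t ht
  have hd := hD x hx t ht
  have hr : ‖2 * (t:ℂ) * GH (fun _ => 1) (n+2) x t‖ ≤ ‖(x:ℂ) * GH (fun _ => 1) (n+1) x t‖ +
      ‖((n:ℂ)+1) * GH (fun _ => 1) n x t‖ := by
    have := K_rec n ht0 x
    rw [add_assoc] at this
    rw [eq_neg_of_add_eq_zero_left this, norm_neg]
    exact norm_add_le _ _
  have hn : ‖(n:ℂ)+1‖ = n + 1 := by
    rw [← Nat.cast_succ, Complex.norm_natCast]; push_cast; rfl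
  simp only [norm_mul, Complex.norm_real, Real.norm_eq_abs, abs_of_pos ht0, abs_of_pos hx0,
    Complex.norm_ofNat, hn] at hr
  have hr2 := mul_le_mul_of_nonneg_left hr (pow_nonneg hx0.le l)
  have : t * (x ^ l * ‖GH (fun _ => 1) (n+2) x t‖) ≤ t * ((D + (n+1) * C) * t ^ a) := by
    have h5 : 0 ≤ t * (x ^ l * ‖GH (fun _ => 1) (n+2) x t‖) := by positivity
    have h6 : ((n:ℝ)+1) * (x ^ l * ‖GH (fun _ => 1) n x t‖) ≤ (n+1) * (C * t ^ (a+1)) := by gcongr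
    have e1 : x ^ (l+1) = x ^ l * x := pow_succ _ _
    have e2 : t ^ (a+1) = t ^ a * t := pow_succ _ _
    rw [e1] at hd
    rw [e2] at hd h6
    linarith
  exact le_of_mul_le_mul_left this ht0

lemma KB_all (n : ℕ) : KB n := by
  have : KB n ∧ KB (n+1) := by
    induction n with
    | zero => exact ⟨KB0, KB1⟩
    | succ n ih => exact ⟨ih.2, KB_step n ih.1 ih.2⟩
  exact this.1

def SchH (v : ℝ → ℂ) : Prop := ContDiff ℝ (⊤:ℕ∞) v ∧ ∀ k l : ℕ, ∃ C : ℝ, ∀ x : ℝ, 0 ≤ x →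
      x ^ l * ‖iteratedDeriv k v x‖ ≤ C

lemma SchH.deriv {v : ℝ → ℂ} (h : SchH v) : SchH (deriv v) := by
  refine ⟨(contDiff_infty_iff_deriv.1 h.1).2, fun k l => ?_⟩
  obtain ⟨C, hC⟩ := h.2 (k+1) l
  exact ⟨C, fun x hx => by rw [← iteratedDeriv_succ']; exact hC x hx⟩

lemma SchH.bound {v : ℝ → ℂ} (h : SchH v) (l : ℕ) :
    ∃ C : ℝ, 0 ≤ C ∧ ∀ x : ℝ, 0 ≤ x → x ^ l * ‖v x‖ ≤ C := by
  obtain ⟨C, hC⟩ := h.2 0 l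
  simp only [iteratedDeriv_zero] at hC
  refine ⟨C, ?_, hC⟩
  exact le_trans (by positivity) (hC 0 le_rfl)

lemma SchH.integrable {v : ℝ → ℂ} (h : SchH v) : IntegrableOn v (Ioi 0) := by
  obtain ⟨A, hA0, hA⟩ := h.bound 0
  obtain ⟨B, hB0, hB⟩ := h.bound 2
  refine (integrable_inv_one_add_sq.integrableOn.mul_const (A + B)).mono'
    h.1.continuous.aestronglyMeasurable ?_
  refine (ae_restrict_mem measurableSet_Ioi).mono fun x hx => ?_
  have hx : 0 < x := hx
  have h1 := hA x hx.le
  have h2 := hB x hx.le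
  rw [← div_eq_inv_mul, le_div_iff₀ (by positivity)]
  simp only [pow_zero, one_mul] at h1
  linarith

lemma SchH.tendsto {v : ℝ → ℂ} (h : SchH v) : Tendsto v atTop (𝓝 0) := by
  obtain ⟨B, hB0, hB⟩ := h.bound 1
  refine squeeze_zero_norm' (a := fun x => B / x) ?_ (tendsto_const_nhds.div_atTop tendsto_id)
  filter_upwards [eventually_gt_atTop 0] with x hx
  have := hB x hx.le
  rw [le_div_iff₀ hx]
  linarith

lemma norm_osc (l y : ℝ) : ‖Complex.exp (-(Complex.I * (l:ℂ) * (y:ℂ)))‖ = 1 := by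
  rw [Complex.norm_exp]
  simp

lemma SchH.integrable_osc {v : ℝ → ℂ} (h : SchH v) (l : ℝ) :
    IntegrableOn (fun y : ℝ => Complex.exp (-(Complex.I * (l:ℂ) * (y:ℂ))) * v y) (Ioi 0) := by
  refine h.integrable.norm.mono' ?_ (Eventually.of_forall fun y => ?_)
  · have := h.1.continuous
    exact Continuous.aestronglyMeasurable (by fun_prop)
  · rw [norm_mul, norm_osc, one_mul]

lemma SchH.good {v : ℝ → ℂ} (h : SchH v) : GoodW (uhatHeat v) := by
  constructor
  · apply Continuous.aestronglyMeasurable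
    unfold uhatHeat
    refine continuous_of_dominated (bound := fun y => ‖v y‖)
      (fun l => (h.integrable_osc l).aestronglyMeasurable) (fun l => Eventually.of_forall fun y => ?_)
      h.integrable.norm (Eventually.of_forall fun y => by fun_prop)
    rw [norm_mul, norm_osc, one_mul]
  · refine ⟨∫ y in Ioi (0:ℝ), ‖v y‖, fun l => ?_⟩
    unfold uhatHeat
    refine (norm_integral_le_integral_norm _).trans (le_of_eq ?_)
    congr 1
    funext y
    rw [norm_mul, norm_osc, one_mul]

lemma uhat_deriv {v : ℝ → ℂ} (h : SchH v) (l : ℝ) :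
    Complex.I * (l:ℂ) * uhatHeat v l = v 0 + uhatHeat (deriv v) l := by
  have hv : ∀ x, HasDerivAt v (deriv v x) x := fun x =>
    (h.1.differentiable (by simp)).differentiableAt.hasDerivAt
  have h0 := integral_Ioi_of_hasDerivAt_of_tendsto' (a := 0) (m := 0)
    (f := fun y : ℝ => Complex.exp (-(Complex.I * (l:ℂ) * (y:ℂ))) * v y)
    (f' := fun y : ℝ => -(Complex.I * (l:ℂ)) * (Complex.exp (-(Complex.I * (l:ℂ) * (y:ℂ))) * v y)
      + Complex.exp (-(Complex.I * (l:ℂ) * (y:ℂ))) * deriv v y) ?_ ?_ ?_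
  · rw [integral_add ((h.integrable_osc l).const_mul _) (h.deriv.integrable_osc l),
      integral_const_mul] at h0
    simp only [Complex.ofReal_zero, mul_zero, neg_zero, Complex.exp_zero, one_mul, zero_sub] at h0
    unfold uhatHeat
    linear_combination -h0
  · intro x _
    have h1 : HasDerivAt (fun z : ℂ => Complex.exp (-(Complex.I * (l:ℂ) * z)))
        (Complex.exp (-(Complex.I * (l:ℂ) * (x:ℂ))) * (-(Complex.I * (l:ℂ) * 1))) (x:ℂ) :=
      (((hasDerivAt_id (x:ℂ)).const_mul (Complex.I * (l:ℂ))).neg).cexp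
    refine (h1.comp_ofReal.mul (hv x)).congr_deriv ?_
    ring
  · exact ((h.integrable_osc l).const_mul _).add (h.deriv.integrable_osc l)
  · rw [tendsto_zero_iff_norm_tendsto_zero]
    have := h.tendsto.norm
    simpa [norm_osc] using this

def DecH (g : ℝ → ℝ → ℂ) : Prop := ∀ (l : ℕ) (T : ℝ), 0 < T → ∃ C : ℝ, ∀ x ≥ (1:ℝ),
  ∀ t ∈ Ioc (0:ℝ) T, x ^ l * ‖g x t‖ ≤ C

lemma GH_succ {v : ℝ → ℂ} (h : SchH v) (n : ℕ) (x : ℝ) {t : ℝ} (ht : 0 < t) :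
    GH (uhatHeat v) (n+1) x t = v 0 * GH (fun _ => 1) n x t + GH (uhatHeat (deriv v)) n x t := by
  unfold GH
  rw [← integral_const_mul, ← integral_add ((integrable_GH goodOne n x ht).const_mul _)
    (integrable_GH h.deriv.good n x ht)]
  congr 1
  funext l
  have := uhat_deriv h l
  linear_combination (Complex.I * (l:ℂ)) ^ n *
    Complex.exp (Complex.I * (l:ℂ) * (x:ℂ) - (l:ℂ)^2 * (t:ℂ)) * this

lemma F_conv {v : ℝ → ℂ} (h : SchH v) (x : ℝ) {t : ℝ} (ht : 0 < t) :
    GH (uhatHeat v) 0 x t = ∫ y in Ioi (0:ℝ), GH (fun _ => 1) 0 (x - y) t * v y := by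
  have e1 : GH (uhatHeat v) 0 x t = ∫ l : ℝ, ∫ y in Ioi (0:ℝ),
      Complex.exp (Complex.I * (l:ℂ) * (x:ℂ) - (l:ℂ)^2 * (t:ℂ)) *
        (Complex.exp (-(Complex.I * (l:ℂ) * (y:ℂ))) * v y) := by
    unfold GH uhatHeat
    congr 1
    funext l
    rw [integral_const_mul, pow_zero, one_mul]
  rw [e1, integral_integral_swap]
  · congr 1
    funext y
    unfold GH
    rw [← integral_mul_const]
    congr 1
    funext l
    rw [← mul_assoc, ← Complex.exp_add]
    simp only [pow_zero, one_mul, mul_one]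
    congr 2
    push_cast
    ring
  · have hg : Integrable (fun l : ℝ => Real.exp (-t * l ^ 2)) := integrable_exp_neg_mul_sq ht
    refine (hg.mul_prod h.integrable.norm).mono' ?_ (Eventually.of_forall fun p => ?_)
    · have := h.1.continuous
      apply Continuous.aestronglyMeasurable
      unfold Function.uncurry
      fun_prop
    · simp only [Function.uncurry]
      rw [norm_mul, norm_mul, norm_kernel, norm_osc, one_mul]

lemma pow_mul_gauss (z : ℝ) {t T : ℝ} (ht : 0 < t) (hT : t ≤ T) (l : ℕ) :
    z ^ (2 * l) * Real.exp (-z^2 / (4 * t)) ≤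
      (8 * T) ^ l * l.factorial * Real.exp (-(1/(8*t)) * z^2) := by
  have h := Real.pow_div_factorial_le_exp (z^2/(8*t)) (by positivity) l
  have hf : (0:ℝ) < l.factorial := by exact_mod_cast l.factorial_pos
  rw [div_le_iff₀ hf, div_pow, div_le_iff₀ (by positivity), ← pow_mul] at h
  have e : Real.exp (-z^2 / (4 * t)) =
      Real.exp (-(1/(8*t)) * z^2) * Real.exp (-(1/(8*t)) * z^2) := by
    rw [← Real.exp_add]; congr 1; field_simp; ring
  have e2 : Real.exp (z^2/(8*t)) * Real.exp (-(1/(8*t)) * z^2) = 1 := by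
    rw [← Real.exp_add, Real.exp_eq_one_iff]; field_simp; ring
  calc z ^ (2 * l) * Real.exp (-z^2 / (4 * t))
      ≤ (Real.exp (z^2/(8*t)) * l.factorial * (8*t)^l) * Real.exp (-z^2 / (4 * t)) := by gcongr
    _ = (8 * t) ^ l * l.factorial * Real.exp (-(1/(8*t)) * z^2) := by
      rw [e]; linear_combination (l.factorial * (8*t)^l * Real.exp (-(1/(8*t)) * z^2)) * e2
    _ ≤ _ := by gcongr

lemma F_dec {v : ℝ → ℂ} (h : SchH v) : DecH (GH (uhatHeat v) 0) := by
  intro l T hT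
  obtain ⟨A, hA0, hA⟩ := h.bound 0
  obtain ⟨B, hB0, hB⟩ := h.bound (2 * l)
  set D : ℝ := 2 ^ (2 * l - 1) * ((8 * T) ^ l * l.factorial * A + B) with hD
  refine ⟨D * √(8 * Real.pi ^ 2), fun x hx t ht => ?_⟩
  have ht0 := ht.1
  have hx0 : 0 < x := by linarith
  have hb : 0 < 1 / (8 * t) := by positivity
  have hgi : Integrable (fun y : ℝ => Real.exp (-(1/(8*t)) * (x - y)^2)) :=
    (integrable_exp_neg_mul_sq hb).comp_sub_left x
  have hgv : ∫ y : ℝ, Real.exp (-(1/(8*t)) * (x - y)^2) = √(Real.pi / (1/(8*t))) := by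
    rw [← integral_gaussian]
    exact integral_sub_left_eq_self (fun y => Real.exp (-(1/(8*t)) * y^2)) volume x
  have hpt : ∀ y : ℝ, 0 < y → x ^ (2*l) * ‖GH (fun _ => 1) 0 (x - y) t * v y‖ ≤
      D * √(Real.pi / t) * Real.exp (-(1/(8*t)) * (x - y)^2) := by
    intro y hy
    rw [norm_mul, K0_norm _ ht0]
    have h1 : x ^ (2*l) ≤ 2 ^ (2*l - 1) * ((x-y)^(2*l) + y^(2*l)) := by
      have := Even.add_pow_le (n := 2*l) (even_two_mul l) (a := x - y) (b := y)
      simpa using this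
    have h2 := pow_mul_gauss (x - y) ht0 ht.2 l
    have h3 := hA y hy.le
    have h4 := hB y hy.le
    simp only [pow_zero, one_mul] at h3
    have h5 : Real.exp (-(x-y)^2 / (4 * t)) ≤ Real.exp (-(1/(8*t)) * (x - y)^2) := by
      apply Real.exp_le_exp.2
      have : 0 ≤ (x-y)^2/(8*t) := by positivity
      have e : -(x-y)^2 / (4 * t) = -(1/(8*t)) * (x - y)^2 - (x-y)^2/(8*t) := by
        field_simp; ring
      linarith
    set E := Real.exp (-(x-y)^2 / (4 * t))
    set E' := Real.exp (-(1/(8*t)) * (x - y)^2)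
    have hE : 0 < E := Real.exp_pos _
    have hE' : 0 < E' := Real.exp_pos _
    have hz : 0 ≤ (x-y)^(2*l) := (even_two_mul l).pow_nonneg _
    calc x ^ (2*l) * (√(Real.pi / t) * E * ‖v y‖)
        ≤ (2 ^ (2*l - 1) * ((x-y)^(2*l) + y^(2*l))) * (√(Real.pi / t) * E * ‖v y‖) := by gcongr
      _ = 2 ^ (2*l - 1) * √(Real.pi / t) *
          (((x-y)^(2*l) * E) * ‖v y‖ + E * (y^(2*l) * ‖v y‖)) := by ring
      _ ≤ 2 ^ (2*l - 1) * √(Real.pi / t) *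
          (((8 * T) ^ l * l.factorial * E') * A + E' * B) := by gcongr
      _ = _ := by rw [hD]; ring
  have hmain : x ^ (2*l) * ‖GH (uhatHeat v) 0 x t‖ ≤ D * √(8 * Real.pi ^ 2) := by
    rw [F_conv h x ht0]
    have hD0 : 0 ≤ D := by rw [hD]; positivity
    calc x ^ (2*l) * ‖∫ y in Ioi (0:ℝ), GH (fun _ => 1) 0 (x - y) t * v y‖
        = ‖∫ y in Ioi (0:ℝ), (x:ℂ) ^ (2*l) * (GH (fun _ => 1) 0 (x - y) t * v y)‖ := by
          rw [integral_const_mul, norm_mul, norm_pow, Complex.norm_real, Real.norm_eq_abs,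
            abs_of_pos hx0]
      _ ≤ ∫ y in Ioi (0:ℝ), D * √(Real.pi / t) * Real.exp (-(1/(8*t)) * (x - y)^2) := by
          refine norm_integral_le_of_norm_le (hgi.const_mul _).integrableOn ?_
          refine (ae_restrict_mem measurableSet_Ioi).mono fun y hy => ?_
          rw [norm_mul, norm_pow, Complex.norm_real, Real.norm_eq_abs, abs_of_pos hx0]
          exact hpt y hy
      _ ≤ ∫ y : ℝ, D * √(Real.pi / t) * Real.exp (-(1/(8*t)) * (x - y)^2) :=
          setIntegral_le_integral (hgi.const_mul _)
            (Eventually.of_forall fun y => by positivity)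
      _ = D * √(8 * Real.pi ^ 2) := by
          rw [integral_const_mul, hgv, mul_assoc, ← Real.sqrt_mul (by positivity)]
          congr 2
          field_simp
  refine le_trans ?_ hmain
  gcongr
  omega

lemma G_dec (n : ℕ) : ∀ v : ℝ → ℂ, SchH v → DecH (GH (uhatHeat v) n) := by
  induction n with
  | zero => intro v h; exact F_dec h
  | succ n ih =>
    intro v h l T hT
    obtain ⟨C, hC⟩ := ih _ h.deriv l T hT
    obtain ⟨B, hB0, hB⟩ := KB_all n 0 l T hT
    refine ⟨‖v 0‖ * B + C, fun x hx t ht => ?_⟩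
    have hx0 : 0 < x := by linarith
    rw [GH_succ h n x ht.1]
    have h1 := hC x hx t ht
    have h2 := hB x hx t ht
    rw [pow_zero, mul_one] at h2
    calc x ^ l * ‖v 0 * GH (fun _ => 1) n x t + GH (uhatHeat (deriv v)) n x t‖
        ≤ x ^ l * (‖v 0‖ * ‖GH (fun _ => 1) n x t‖ + ‖GH (uhatHeat (deriv v)) n x t‖) := by
          gcongr
          exact (norm_add_le _ _).trans (by rw [norm_mul])
      _ = ‖v 0‖ * (x ^ l * ‖GH (fun _ => 1) n x t‖) + x ^ l * ‖GH (uhatHeat (deriv v)) n x t‖ := by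
          ring
      _ ≤ _ := by gcongr

lemma FHeat_eq (u₀ : ℝ → ℂ) (x t : ℝ) : FHeat u₀ x t = GH (uhatHeat u₀) 0 x t := by
  unfold FHeat GH
  simp only [pow_zero, one_mul]

theorem stmt10 (u₀ : ℝ → ℂ) (hu : ContDiff ℝ (⊤:ℕ∞) u₀)
    (hdecay : ∀ k l : ℕ, ∃ C : ℝ, ∀ x : ℝ, 0 ≤ x →
      x ^ l * ‖iteratedDeriv k u₀ x‖ ≤ C) :
    ContDiffOn ℝ (⊤:ℕ∞) (fun p : ℝ × ℝ => FHeat u₀ p.1 p.2)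
      (Ioi (0:ℝ) ×ˢ Ioi (0:ℝ)) ∧
    ∀ k m l : ℕ, ∀ T₀ > (0:ℝ), ∀ δ > (0:ℝ), ∃ X : ℝ, ∀ x ≥ X, ∀ t ∈ Ioc (0:ℝ) T₀,
      x ^ l *
        ‖iteratedDeriv k (fun y => iteratedDeriv m (fun s => FHeat u₀ y s) t) x‖ < δ := by
  have h : SchH u₀ := ⟨hu, hdecay⟩
  simp only [FHeat_eq]
  constructor
  · refine contDiffOn_infty.2 fun N => (contDiffOn_GH h.good N 0).mono ?_
    exact prod_mono (subset_univ _) subset_rfl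
  · intro k m l T hT δ hδ
    obtain ⟨C, hC⟩ := G_dec (0 + 2 * m + k) u₀ h (l+1) T hT
    refine ⟨max 1 (C / δ + 1), fun x hx t ht => ?_⟩
    have hx1 : 1 ≤ x := (le_max_left _ _).trans hx
    have hx2 : C / δ + 1 ≤ x := (le_max_right _ _).trans hx
    have hx0 : 0 < x := by linarith
    have e : (fun y => iteratedDeriv m (fun s => GH (uhatHeat u₀) 0 y s) t) =
        fun y => GH (uhatHeat u₀) (0 + 2 * m) y t := by
      funext y
      exact iteratedDeriv_GH_t h.good m 0 y t ht.1
    rw [e, iteratedDeriv_GH_x h.good k _ ht.1]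
    have h1 := hC x hx1 t ht
    have h2 : C < x * δ := by
      rw [← div_lt_iff₀ hδ]; linarith
    rw [pow_succ, mul_comm (x ^ l), mul_assoc] at h1
    exact lt_of_mul_lt_mul_left (h1.trans_lt h2) hx0.le
end

section
/- Let W be a real-valued function of class C² on ([0,∞)×[0,∞)) ∖ {(0,0)} satisfying: (i) W_t = W_{xx} on Q; (ii) W(x,0) = 0 for all x > 0 and W(0,t) = 0 for all t > 0; (iii) for every t > 0, lim_{x→∞} W(x,t) = 0 and sup_{x ≥ 1} |W_x(x,t)| < ∞; (iv) for every T > 0 there exists a function B_T : (0,∞) → [0,∞) with ∫₀^∞ B_T(x) dx < ∞ such that |W(x,t)|² ≤ B_T(x) and |W_t(x,t)|² ≤ B_T(x) for all x > 0 and 0 < t ≤ T. Then W ≡ 0 on Q. In particular, any two solutions of the Dirichlet initial-boundary-value problem for the forced heat equation U_t − U_{xx} = f on Q with the same data, each satisfying conditions (iii) and (iv), coincide. -/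
open MeasureTheory Filter Set Topology

lemma slice_nonpos (w : ℝ → ℝ) (hw : ContDiffOn ℝ 2 w (Ici 0)) (h0 : w 0 = 0)
    (hlim : Tendsto w atTop (𝓝 0)) (hbd : ∃ C : ℝ, ∀ x ≥ (1:ℝ), |deriv w x| ≤ C)
    (hwint : IntegrableOn (fun x => w x * iteratedDeriv 2 w x) (Ioi 0)) :
    ∫ x in Ioi (0:ℝ), w x * iteratedDeriv 2 w x ≤ 0 := by
  have hud : UniqueDiffOn ℝ (Ici (0:ℝ)) := uniqueDiffOn_Ici 0
  have hc1 : ContinuousOn (derivWithin w (Ici 0)) (Ici 0) :=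
    hw.continuousOn_derivWithin hud (by norm_num)
  have heq : ∀ x > (0:ℝ), derivWithin w (Ici 0) x = deriv w x := fun x hx =>
    derivWithin_of_mem_nhds (Ici_mem_nhds hx)
  have hG : Tendsto (fun x => w x * derivWithin w (Ici 0) x) atTop (𝓝 0) := by
    obtain ⟨C, hC⟩ := hbd
    refine hlim.zero_mul_isBoundedUnder_le ?_
    refine ⟨C, ?_⟩
    rw [eventually_map]
    filter_upwards [eventually_ge_atTop (1:ℝ)] with x hx
    simp only [Function.comp, Real.norm_eq_abs]
    rw [heq x (by linarith)]
    exact hC x hx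
  have hI := intervalIntegral_tendsto_integral_Ioi 0 hwint tendsto_id
  refine le_of_tendsto_of_tendsto hI hG ?_
  filter_upwards [eventually_ge_atTop (1:ℝ)] with R hR
  have hcd : ∀ x > (0:ℝ), ContDiffAt ℝ 2 w x := fun x hx => hw.contDiffAt (Ici_mem_nhds hx)
  have := intervalIntegral.integral_le_sub_of_hasDeriv_right_of_le (a := 0) (b := R)
    (g := fun x => w x * derivWithin w (Ici 0) x)
    (g' := fun x => deriv w x * deriv w x + w x * iteratedDeriv 2 w x)
    (φ := fun x => w x * iteratedDeriv 2 w x) (by linarith)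
    ((hw.continuousOn.mul hc1).mono Icc_subset_Ici_self)
    (by
      intro x hx
      have hx0 : 0 < x := hx.1
      have h1 : HasDerivAt w (deriv w x) x :=
        ((hcd x hx0).differentiableAt (by norm_num)).hasDerivAt
      have h2 : HasDerivAt (deriv w) (iteratedDeriv 2 w x) x := by
        have : DifferentiableAt ℝ (deriv w) x := by
          have h21 : ContDiffOn ℝ (1 + 1) w (Ioi 0) := by
            have h := hw.mono Ioi_subset_Ici_self
            rwa [show (2 : WithTop ℕ∞) = 1 + 1 by norm_num] at h
          have h := ((contDiffOn_succ_iff_deriv_of_isOpen isOpen_Ioi).1 h21).2.2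
          exact (h.contDiffAt (Ioi_mem_nhds hx0)).differentiableAt (by norm_num)
        rw [iteratedDeriv_succ, iteratedDeriv_one]
        exact this.hasDerivAt
      have h3 : HasDerivAt (fun y => w y * derivWithin w (Ici 0) y)
          (deriv w x * deriv w x + w x * iteratedDeriv 2 w x) x := by
        refine (h1.mul h2).congr_of_eventuallyEq ?_
        filter_upwards [Ioi_mem_nhds hx0] with y hy
        simp [heq y hy]
      exact h3.hasDerivWithinAt)
    (by
      rw [integrableOn_Icc_iff_integrableOn_Ioc]
      exact hwint.mono_set Ioc_subset_Ioi_self)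
    (by
      intro x hx
      nlinarith [mul_self_nonneg (deriv w x)])
  simpa [h0] using this

theorem stmt11 (W : ℝ → ℝ → ℝ)
    (hreg : ContDiffOn ℝ 2 (fun p : ℝ × ℝ => W p.1 p.2)
      ((Ici (0:ℝ) ×ˢ Ici (0:ℝ)) \ {((0:ℝ), (0:ℝ))}))
    (hpde : ∀ x > (0:ℝ), ∀ t > (0:ℝ),
      deriv (fun s => W x s) t = iteratedDeriv 2 (fun y => W y t) x)
    (hinit : ∀ x > (0:ℝ), W x 0 = 0)
    (hbdry : ∀ t > (0:ℝ), W 0 t = 0)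
    (hlim : ∀ t > (0:ℝ), Tendsto (fun x => W x t) atTop (𝓝 0))
    (hbd : ∀ t > (0:ℝ), ∃ C : ℝ, ∀ x ≥ (1:ℝ), |deriv (fun y => W y t) x| ≤ C)
    (hB : ∀ T > (0:ℝ), ∃ B : ℝ → ℝ, (∀ x > (0:ℝ), 0 ≤ B x) ∧
      IntegrableOn B (Ioi (0:ℝ)) ∧
      ∀ x > (0:ℝ), ∀ t ∈ Ioc (0:ℝ) T,
        (W x t)^2 ≤ B x ∧ (deriv (fun s => W x s) t)^2 ≤ B x) :
    ∀ x > (0:ℝ), ∀ t > (0:ℝ), W x t = 0 := by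
  have hsl : ∀ t > (0:ℝ), ContDiffOn ℝ 2 (fun y => W y t) (Ici 0) := by
    intro t ht
    refine hreg.comp (f := fun y : ℝ => (y, t)) (by fun_prop) ?_
    intro y hy
    refine ⟨⟨hy, ht.le⟩, ?_⟩
    simp only [mem_singleton_iff, Prod.mk.injEq, not_and]
    intro _; exact ht.ne'
  have hst : ∀ x > (0:ℝ), ContDiffOn ℝ 2 (fun s => W x s) (Ici 0) := by
    intro x hx
    refine hreg.comp (f := fun s : ℝ => (x, s)) (by fun_prop) ?_
    intro y hy
    refine ⟨⟨hx.le, hy⟩, ?_⟩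
    simp only [mem_singleton_iff, Prod.mk.injEq, not_and]
    intro h; exact absurd h hx.ne'
  have hdt : ∀ x > (0:ℝ), ∀ t > (0:ℝ),
      HasDerivAt (fun s => W x s) (deriv (fun s => W x s) t) t := fun x hx t ht =>
    (((hst x hx).contDiffAt (Ici_mem_nhds ht)).differentiableAt (by norm_num)).hasDerivAt
  have hmeas : ∀ t > (0:ℝ), AEStronglyMeasurable (fun x => (W x t)^2)
      (volume.restrict (Ioi 0)) := fun t ht =>
    (((hsl t ht).continuousOn.mono Ioi_subset_Ici_self).pow 2).aestronglyMeasurable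
      measurableSet_Ioi
  have hmeas2 : ∀ t > (0:ℝ), AEStronglyMeasurable
      (fun x => W x t * iteratedDeriv 2 (fun y => W y t) x)
      (volume.restrict (Ioi 0)) := by
    intro t ht
    refine ContinuousOn.aestronglyMeasurable ?_ measurableSet_Ioi
    refine ((hsl t ht).continuousOn.mono Ioi_subset_Ici_self).mul ?_
    have h := ((hsl t ht).mono Ioi_subset_Ici_self).continuousOn_iteratedDerivWithin
      (m := 2) le_rfl (uniqueDiffOn_Ioi 0)
    refine h.congr ?_
    intro x hx
    exact (iteratedDerivWithin_of_isOpen isOpen_Ioi hx).symm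
  have hbound : ∀ a b c : ℝ, a^2 ≤ c → b^2 ≤ c → |a * b| ≤ c := by
    intro a b c h1 h2
    rw [abs_le]
    constructor <;> nlinarith [sq_nonneg (a+b), sq_nonneg (a-b)]
  set E : ℝ → ℝ := fun t => ∫ x in Ioi (0:ℝ), (W x t)^2 with hE
  have hintE : ∀ t > (0:ℝ), IntegrableOn (fun x => (W x t)^2) (Ioi 0) := by
    intro t ht
    obtain ⟨B, hB0, hBi, hBb⟩ := hB t ht
    refine Integrable.mono' hBi (hmeas t ht) ?_
    filter_upwards [ae_restrict_mem measurableSet_Ioi] with x hx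
    rw [Real.norm_of_nonneg (sq_nonneg _)]
    exact (hBb x hx t ⟨ht, le_rfl⟩).1
  have hintP : ∀ t > (0:ℝ), IntegrableOn
      (fun x => W x t * iteratedDeriv 2 (fun y => W y t) x) (Ioi 0) := by
    intro t ht
    obtain ⟨B, hB0, hBi, hBb⟩ := hB t ht
    refine Integrable.mono' hBi (hmeas2 t ht) ?_
    filter_upwards [ae_restrict_mem measurableSet_Ioi] with x hx
    have h := hBb x hx t ⟨ht, le_rfl⟩
    rw [Real.norm_eq_abs, ← hpde x hx t ht]
    exact hbound _ _ _ h.1 h.2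
  have hderiv : ∀ t > (0:ℝ), HasDerivAt E
      (∫ x in Ioi (0:ℝ), 2 * (W x t * deriv (fun s => W x s) t)) t := by
    intro t ht
    obtain ⟨B, hB0, hBi, hBb⟩ := hB (t+1) (by linarith)
    refine (hasDerivAt_integral_of_dominated_loc_of_deriv_le (μ := volume.restrict (Ioi (0:ℝ)))
      (F := fun s x => (W x s)^2) (F' := fun s x => 2 * (W x s * deriv (fun r => W x r) s))
      (bound := fun x => 2 * B x) (x₀ := t) (s := Ioo 0 (t+1))
      (Ioo_mem_nhds ht (by linarith)) ?_ (hintE t ht) ?_ ?_ (hBi.const_mul 2) ?_).2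
    · filter_upwards [Ioi_mem_nhds ht] with s hs using hmeas s hs
    · refine ((hmeas2 t ht).const_mul 2).congr ?_
      filter_upwards [ae_restrict_mem measurableSet_Ioi] with x hx
      rw [hpde x hx t ht]
    · filter_upwards [ae_restrict_mem measurableSet_Ioi] with x hx s hs
      have h := hBb x hx s ⟨hs.1, hs.2.le⟩
      rw [Real.norm_eq_abs, abs_mul, abs_two]
      exact mul_le_mul_of_nonneg_left (hbound _ _ _ h.1 h.2) (by norm_num)
    · filter_upwards [ae_restrict_mem measurableSet_Ioi] with x hx s hs
      have h := (hdt x hx s hs.1).fun_pow 2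
      have he : 2 * (W x s * deriv (fun r => W x r) s)
          = ((2:ℕ):ℝ) * W x s ^ (2 - 1) * deriv (fun r => W x r) s := by
        norm_num
        ring
      simp only [he]
      exact h
  have hnonpos : ∀ t > (0:ℝ), deriv E t ≤ 0 := by
    intro t ht
    rw [(hderiv t ht).deriv, integral_const_mul]
    have h := slice_nonpos (fun y => W y t) (hsl t ht) (hbdry t ht) (hlim t ht) (hbd t ht)
      (hintP t ht)
    have h2 : ∫ x in Ioi (0:ℝ), W x t * deriv (fun s => W x s) t
        = ∫ x in Ioi (0:ℝ), W x t * iteratedDeriv 2 (fun y => W y t) x := by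
      refine setIntegral_congr_fun measurableSet_Ioi ?_
      intro x hx
      simp only
      rw [hpde x hx t ht]
    rw [h2]
    linarith
  have hanti : AntitoneOn E (Ioi 0) := by
    refine antitoneOn_of_deriv_nonpos (convex_Ioi 0)
      (fun t ht => (hderiv t ht).continuousAt.continuousWithinAt) ?_ ?_
    · intro t ht
      rw [interior_Ioi] at ht
      exact (hderiv t ht).differentiableAt.differentiableWithinAt
    · intro t ht
      rw [interior_Ioi] at ht
      exact hnonpos t ht
  have hzero : Tendsto E (𝓝[>] 0) (𝓝 0) := by
    obtain ⟨B, hB0, hBi, hBb⟩ := hB 1 one_pos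
    have h : Tendsto E (𝓝[>] 0) (𝓝 (∫ x in Ioi (0:ℝ), (0:ℝ))) := by
      refine tendsto_integral_filter_of_dominated_convergence B ?_ ?_ hBi ?_
      · filter_upwards [self_mem_nhdsWithin] with s hs using hmeas s hs
      · filter_upwards [Ioc_mem_nhdsGT (zero_lt_one' ℝ)] with s hs
        filter_upwards [ae_restrict_mem measurableSet_Ioi] with x hx
        rw [Real.norm_of_nonneg (sq_nonneg _)]
        exact (hBb x hx s hs).1
      · filter_upwards [ae_restrict_mem measurableSet_Ioi] with x hx
        have h := (((hst x hx).continuousOn.fun_pow 2) 0 self_mem_Ici).mono_left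
          (nhdsWithin_mono 0 Ioi_subset_Ici_self)
        simpa [hinit x hx] using h
    simpa using h
  intro x hx t ht
  have hEt : E t ≤ 0 := by
    refine ge_of_tendsto hzero ?_
    filter_upwards [Ioc_mem_nhdsGT ht] with s hs
    exact hanti hs.1 ht hs.2
  have hEt0 : E t = 0 := le_antisymm hEt (integral_nonneg fun x => sq_nonneg _)
  have hae := (integral_eq_zero_iff_of_nonneg (fun x => sq_nonneg (W x t)) (hintE t ht)).1 hEt0
  have := Measure.eqOn_open_of_ae_eq hae isOpen_Ioi
    (((hsl t ht).continuousOn.mono Ioi_subset_Ici_self).pow 2) continuousOn_const hx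
  simpa using this
end

section
/- Let α > 0 and β > 0, and let w be a real-valued function of class C³ on ([0,∞)×[0,∞)) ∖ {(0,0)} satisfying: (i) w_t − α w_{xxt} + β w_x = 0 on Q; (ii) w(x,0) = 0 for all x > 0 and w(0,t) = 0 for all t > 0; (iii) for every t > 0, lim_{x→∞} w(x,t) = 0 and sup_{x ≥ 1} |w_{xt}(x,t)| < ∞; (iv) for every T > 0 there exists a function M_T : (0,∞) → [0,∞) with ∫₀^∞ M_T(x) dx < ∞ such that |w(x,t)|² ≤ M_T(x), |w_x(x,t)|² ≤ M_T(x), |w_t(x,t)|² ≤ M_T(x), and |w_{xt}(x,t)|² ≤ M_T(x) for all x > 0 and 0 < t ≤ T. Then w ≡ 0 on Q. In particular, any two solutions of the Dirichlet initial-boundary-value problem for the forced linearized BBM equation u_t − α u_{xxt} + β u_x = f on Q with the same data, each satisfying (iii) and (iv), coincide. -/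
open MeasureTheory Filter Set Topology

/-- The closed quarter-plane without the corner. -/
def qS : Set (ℝ × ℝ) := (Ici (0:ℝ) ×ˢ Ici (0:ℝ)) \ {((0:ℝ), (0:ℝ))}

/-- Partial derivative in direction `v`, within the punctured closed quarter-plane. -/
noncomputable def qD (v : ℝ × ℝ) (g : ℝ × ℝ → ℝ) : ℝ × ℝ → ℝ := fun p => fderivWithin ℝ g qS p v

lemma qS_unique : UniqueDiffOn ℝ qS := by
  have h : UniqueDiffOn ℝ (Ici (0:ℝ) ×ˢ Ici (0:ℝ)) := (uniqueDiffOn_Ici 0).prod (uniqueDiffOn_Ici 0)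
  exact h.inter isOpen_compl_singleton

lemma qS_mem_left {x t : ℝ} (hx : 0 < x) (ht : 0 ≤ t) : (x, t) ∈ qS := by
  refine ⟨⟨hx.le, ht⟩, ?_⟩
  simp [hx.ne']

lemma qS_mem_right {x t : ℝ} (hx : 0 ≤ x) (ht : 0 < t) : (x, t) ∈ qS := by
  refine ⟨⟨hx, ht.le⟩, ?_⟩
  simp [ht.ne']

lemma qS_nhds {x t : ℝ} (hx : 0 < x) (ht : 0 < t) : qS ∈ 𝓝 (x, t) := by
  have : Ioi (0:ℝ) ×ˢ Ioi (0:ℝ) ∈ 𝓝 (x, t) := prod_mem_nhds (Ioi_mem_nhds hx) (Ioi_mem_nhds ht)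
  filter_upwards [this] with p hp
  exact qS_mem_left hp.1 (le_of_lt hp.2)

lemma qD_contDiffOn {m n : WithTop ℕ∞} (hmn : m + 1 ≤ n) (v : ℝ × ℝ) {g : ℝ × ℝ → ℝ}
    (hg : ContDiffOn ℝ n g qS) : ContDiffOn ℝ m (qD v g) qS :=
  (hg.fderivWithin qS_unique hmn).clm_apply contDiffOn_const

lemma qD_hasDerivAt_x {g : ℝ × ℝ → ℝ} (hg : DifferentiableOn ℝ g qS) {x t : ℝ} (hx : 0 < x)
    (ht : 0 ≤ t) : HasDerivAt (fun y => g (y, t)) (qD (1, 0) g (x, t)) x := by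
  have h1 := (hg (x, t) (qS_mem_left hx ht)).hasFDerivWithinAt
  have h2 : HasDerivWithinAt (fun y : ℝ => (y, t)) ((1:ℝ), (0:ℝ)) (Ioi 0) x :=
    ((hasDerivAt_id x).prodMk (hasDerivAt_const x t)).hasDerivWithinAt
  have h3 : MapsTo (fun y : ℝ => (y, t)) (Ioi 0) qS := fun y hy => qS_mem_left hy ht
  exact (h1.comp_hasDerivWithinAt x h2 h3).hasDerivAt (Ioi_mem_nhds hx)

lemma qD_hasDerivAt_t {g : ℝ × ℝ → ℝ} (hg : DifferentiableOn ℝ g qS) {x t : ℝ} (hx : 0 < x)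
    (ht : 0 < t) : HasDerivAt (fun s => g (x, s)) (qD (0, 1) g (x, t)) t := by
  have h1 := (hg (x, t) (qS_mem_left hx ht.le)).hasFDerivWithinAt
  have h2 : HasDerivWithinAt (fun s : ℝ => (x, s)) ((0:ℝ), (1:ℝ)) (Ioi 0) t :=
    ((hasDerivAt_const t x).prodMk (hasDerivAt_id t)).hasDerivWithinAt
  have h3 : MapsTo (fun s : ℝ => (x, s)) (Ioi 0) qS := fun y hy => qS_mem_right hx.le hy
  exact (h1.comp_hasDerivWithinAt t h2 h3).hasDerivAt (Ioi_mem_nhds ht)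

lemma qD_symm {g : ℝ × ℝ → ℝ} (hg : ContDiffOn ℝ 3 g qS) {x t : ℝ} (hx : 0 < x) (ht : 0 < t)
    (u v : ℝ × ℝ) : qD u (qD v g) (x, t) = qD v (qD u g) (x, t) := by
  have hc : ContDiffAt ℝ 3 g (x, t) := hg.contDiffAt (qS_nhds hx ht)
  have hs : IsSymmSndFDerivAt ℝ g (x, t) := hc.isSymmSndFDerivAt (by simp; norm_num)
  have hd : DifferentiableAt ℝ (fderiv ℝ g) (x, t) :=
    (hc.fderiv_right (m := 2) (by norm_num)).differentiableAt (by norm_num)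
  have key : ∀ u v : ℝ × ℝ, qD u (qD v g) (x, t) = fderiv ℝ (fderiv ℝ g) (x, t) u v := by
    intro u v
    have he : qD v g =ᶠ[𝓝 (x, t)] fun p => fderiv ℝ g p v := by
      have : Ioi (0:ℝ) ×ˢ Ioi (0:ℝ) ∈ 𝓝 (x, t) :=
        prod_mem_nhds (Ioi_mem_nhds hx) (Ioi_mem_nhds ht)
      filter_upwards [this] with p hp
      unfold qD
      rw [fderivWithin_of_mem_nhds (qS_nhds hp.1 hp.2)]
    show fderivWithin ℝ (qD v g) qS (x, t) u = _
    rw [fderivWithin_of_mem_nhds (qS_nhds hx ht), he.fderiv_eq,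
      fderiv_clm_apply hd (differentiableAt_const v)]
    simp
  rw [key, key]
  exact hs u v

lemma q_cont_x {g : ℝ × ℝ → ℝ} (hg : ContinuousOn g qS) {t : ℝ} (ht : 0 ≤ t) :
    ContinuousOn (fun x => g (x, t)) (Ioi 0) :=
  hg.comp (by fun_prop) (fun _ hx => qS_mem_left hx ht)

lemma q_tendsto_t {g : ℝ × ℝ → ℝ} (hg : ContinuousOn g qS) {x : ℝ} (hx : 0 < x) :
    Tendsto (fun t => g (x, t)) (𝓝[>] 0) (𝓝 (g (x, 0))) := by
  have h1 : ContinuousOn (fun t => g (x, t)) (Ici 0) :=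
    hg.comp (by fun_prop) (fun _ ht => qS_mem_left hx ht)
  exact (h1 0 self_mem_Ici).mono_left (nhdsWithin_mono _ Ioi_subset_Ici_self)

lemma q_cont_0 {g : ℝ × ℝ → ℝ} (hg : ContinuousOn g qS) {t : ℝ} (ht : 0 < t) :
    Tendsto (fun x => g (x, t)) (𝓝[>] 0) (𝓝 (g (0, t))) := by
  have h1 : ContinuousOn (fun x => g (x, t)) (Ici 0) :=
    hg.comp (by fun_prop) (fun _ hx => qS_mem_right hx ht)
  exact (h1 0 self_mem_Ici).mono_left (nhdsWithin_mono _ Ioi_subset_Ici_self)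

lemma bbm_core (α β : ℝ) (hα : 0 < α) (f : ℝ × ℝ → ℝ)
    (hf : ContDiffOn ℝ 3 f qS)
    (hpde : ∀ x > (0:ℝ), ∀ t > (0:ℝ),
      qD (0, 1) f (x, t) - α * qD (1, 0) (qD (1, 0) (qD (0, 1) f)) (x, t)
        + β * qD (1, 0) f (x, t) = 0)
    (hinit : ∀ x > (0:ℝ), f (x, 0) = 0)
    (hbdry : ∀ t > (0:ℝ), f (0, t) = 0)
    (hlim : ∀ t > (0:ℝ), Tendsto (fun x => f (x, t)) atTop (𝓝 0))
    (hbd : ∀ t > (0:ℝ), ∃ C : ℝ, ∀ x ≥ (1:ℝ), |qD (1, 0) (qD (0, 1) f) (x, t)| ≤ C)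
    (hM : ∀ T > (0:ℝ), ∃ M : ℝ → ℝ, (∀ x > (0:ℝ), 0 ≤ M x) ∧
      IntegrableOn M (Ioi (0:ℝ)) ∧
      ∀ x > (0:ℝ), ∀ t ∈ Ioc (0:ℝ) T,
        (f (x, t))^2 ≤ M x ∧ (qD (1, 0) f (x, t))^2 ≤ M x ∧
        (qD (0, 1) f (x, t))^2 ≤ M x ∧
        (qD (1, 0) (qD (0, 1) f) (x, t))^2 ≤ M x) :
    ∀ x > (0:ℝ), ∀ t > (0:ℝ), f (x, t) = 0 := by
  have hfx : ContDiffOn ℝ 2 (qD (1, 0) f) qS := qD_contDiffOn (by norm_num) _ hf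
  have hft : ContDiffOn ℝ 2 (qD (0, 1) f) qS := qD_contDiffOn (by norm_num) _ hf
  have hftx : ContDiffOn ℝ 1 (qD (1, 0) (qD (0, 1) f)) qS := qD_contDiffOn (by norm_num) _ hft
  have df : DifferentiableOn ℝ f qS := hf.differentiableOn (by norm_num)
  have dfx : DifferentiableOn ℝ (qD (1, 0) f) qS := hfx.differentiableOn (by norm_num)
  have dft : DifferentiableOn ℝ (qD (0, 1) f) qS := hft.differentiableOn (by norm_num)
  have dftx : DifferentiableOn ℝ (qD (1, 0) (qD (0, 1) f)) qS := hftx.differentiableOn (by norm_num)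
  have hsymm : ∀ x > (0:ℝ), ∀ t > (0:ℝ), qD (0, 1) (qD (1, 0) f) (x, t) =
      qD (1, 0) (qD (0, 1) f) (x, t) := fun x hx t ht => qD_symm hf hx ht _ _
  have hx0 : ∀ x > (0:ℝ), qD (1, 0) f (x, 0) = 0 := by
    intro x hx
    have h1 := qD_hasDerivAt_x df hx le_rfl
    have h2 : (fun y => f (y, 0)) =ᶠ[𝓝 x] fun _ => 0 := by
      filter_upwards [Ioi_mem_nhds hx] with y hy using hinit y hy
    exact h1.unique ((hasDerivAt_const x (0:ℝ)).congr_of_eventuallyEq h2)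
  set a := f with ha
  set b := qD (1, 0) f with hb
  set c := qD (0, 1) f with hc
  set d := qD (1, 0) c with hd
  set e : ℝ → ℝ → ℝ := fun t x => (a (x, t))^2 + α * (b (x, t))^2 with he
  set eder : ℝ → ℝ → ℝ := fun t x => 2 * (a (x, t) * c (x, t) + α * (b (x, t) * d (x, t))) with heder
  have econt : ∀ t ≥ (0:ℝ), ContinuousOn (e t) (Ioi 0) := by
    intro t ht
    exact ((q_cont_x df.continuousOn ht).pow 2).add
      (continuousOn_const.mul ((q_cont_x dfx.continuousOn ht).pow 2))
  have edercont : ∀ t ≥ (0:ℝ), ContinuousOn (eder t) (Ioi 0) := by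
    intro t ht
    exact continuousOn_const.mul (((q_cont_x df.continuousOn ht).mul
      (q_cont_x dft.continuousOn ht)).add (continuousOn_const.mul
      ((q_cont_x dfx.continuousOn ht).mul (q_cont_x dftx.continuousOn ht))))
  have emeas : ∀ t ≥ (0:ℝ), AEStronglyMeasurable (e t) (volume.restrict (Ioi 0)) :=
    fun t ht => (econt t ht).aestronglyMeasurable measurableSet_Ioi
  have edermeas : ∀ t ≥ (0:ℝ), AEStronglyMeasurable (eder t) (volume.restrict (Ioi 0)) :=
    fun t ht => (edercont t ht).aestronglyMeasurable measurableSet_Ioi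
  -- domination
  have hdom : ∀ T > (0:ℝ), ∃ M : ℝ → ℝ, IntegrableOn M (Ioi (0:ℝ)) ∧
      ∀ x > (0:ℝ), ∀ t ∈ Ioc (0:ℝ) T, ‖e t x‖ ≤ M x ∧ ‖eder t x‖ ≤ M x := by
    intro T hT
    obtain ⟨M, hM0, hMi, hMb⟩ := hM T hT
    refine ⟨fun x => (2 * (1 + α)) * M x, hMi.const_mul _, ?_⟩
    intro x hx t ht
    obtain ⟨h1, h2, h3, h4⟩ := hMb x hx t ht
    have hm := hM0 x hx
    have k1 : α * (b (x, t))^2 ≤ α * M x := mul_le_mul_of_nonneg_left h2 hα.le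
    have k2 : 0 ≤ α * M x := by positivity
    constructor
    · rw [Real.norm_eq_abs, abs_of_nonneg (by simp only [he]; positivity)]
      simp only [he]
      nlinarith
    · have k3 : |b (x, t) * d (x, t)| ≤ M x := by
        rw [abs_le]
        constructor <;> nlinarith [sq_nonneg (b (x, t) + d (x, t)), sq_nonneg (b (x, t) - d (x, t))]
      have k4 : |a (x, t) * c (x, t)| ≤ M x := by
        rw [abs_le]
        constructor <;> nlinarith [sq_nonneg (a (x, t) + c (x, t)), sq_nonneg (a (x, t) - c (x, t))]
      have k5 : |α * (b (x, t) * d (x, t))| ≤ α * M x := by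
        rw [abs_mul, abs_of_pos hα]
        exact mul_le_mul_of_nonneg_left k3 hα.le
      simp only [heder, Real.norm_eq_abs]
      rw [abs_mul, abs_two]
      have := abs_add_le (a (x, t) * c (x, t)) (α * (b (x, t) * d (x, t)))
      nlinarith
  have eint : ∀ t > (0:ℝ), IntegrableOn (e t) (Ioi 0) := by
    intro t ht
    obtain ⟨M, hMi, hMb⟩ := hdom t ht
    refine Integrable.mono' hMi (emeas t ht.le) ?_
    filter_upwards [ae_restrict_mem measurableSet_Ioi] with x hx
    exact (hMb x hx t ⟨ht, le_rfl⟩).1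
  have ederint : ∀ t > (0:ℝ), IntegrableOn (eder t) (Ioi 0) := by
    intro t ht
    obtain ⟨M, hMi, hMb⟩ := hdom t ht
    refine Integrable.mono' hMi (edermeas t ht.le) ?_
    filter_upwards [ae_restrict_mem measurableSet_Ioi] with x hx
    exact (hMb x hx t ⟨ht, le_rfl⟩).2
  -- the flux identity
  have hzero : ∀ t > (0:ℝ), ∫ x in Ioi 0, eder t x = 0 := by
    intro t ht
    set F : ℝ → ℝ := fun x => 2 * α * (a (x, t) * d (x, t)) - β * (a (x, t))^2 with hF
    have hF0 : F 0 = 0 := by simp [hF, hbdry t ht]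
    have hFc : ContinuousWithinAt F (Ici 0) 0 := by
      rw [← continuousWithinAt_Ioi_iff_Ici]
      have h1 := q_cont_0 df.continuousOn ht
      have h2 := q_cont_0 dftx.continuousOn ht
      exact ((h1.mul h2).const_mul (2 * α)).sub ((h1.pow 2).const_mul β)
    have hFd : ∀ x ∈ Ioi (0:ℝ), HasDerivAt F (eder t x) x := by
      intro x hx
      have h1 := qD_hasDerivAt_x df hx ht.le
      have h2 := qD_hasDerivAt_x dftx hx ht.le
      have h3 := ((h1.mul h2).const_mul (2 * α)).sub ((h1.pow 2).const_mul β)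
      refine HasDerivAt.congr_deriv (f := F) h3 ?_
      have := hpde x hx t ht
      change _ = 2 * (a (x, t) * c (x, t) + α * (b (x, t) * d (x, t)))
      change 2 * α * (b (x, t) * d (x, t) + a (x, t) * qD (1, 0) d (x, t)) -
        β * (((2:ℕ):ℝ) * a (x, t) ^ 1 * b (x, t)) = _
      push_cast
      linear_combination (-2 * a (x, t)) * this
    have hFi : Tendsto F atTop (𝓝 0) := by
      obtain ⟨C, hC⟩ := hbd t ht
      have h1 : Tendsto (fun x => a (x, t) * d (x, t)) atTop (𝓝 0) := by
        refine Tendsto.zero_mul_isBoundedUnder_le (hlim t ht) ?_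
        refine ⟨C, ?_⟩
        rw [eventually_map]
        filter_upwards [eventually_ge_atTop 1] with x hx
        exact hC x hx
      have h2 := (h1.const_mul (2 * α)).sub (((hlim t ht).pow 2).const_mul β)
      simpa using h2
    rw [integral_Ioi_of_hasDerivAt_of_tendsto hFc hFd (ederint t ht) hFi, hF0, sub_zero]
  set E : ℝ → ℝ := fun t => ∫ x in Ioi 0, e t x with hE
  have hEd : ∀ t > (0:ℝ), HasDerivAt E 0 t := by
    intro t ht
    obtain ⟨M, hMi, hMb⟩ := hdom (t + 1) (by linarith)
    have hs : Ioo 0 (t + 1) ∈ 𝓝 t := Ioo_mem_nhds ht (by linarith)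
    have := hasDerivAt_integral_of_dominated_loc_of_deriv_le (μ := volume.restrict (Ioi (0:ℝ)))
      (F := e) (F' := eder) (x₀ := t) (s := Ioo 0 (t + 1)) (bound := M) hs
      (by filter_upwards [hs] with s hs using emeas s hs.1.le)
      (eint t ht) (edermeas t ht.le)
      (by
        filter_upwards [ae_restrict_mem measurableSet_Ioi] with x hx s hs
        exact (hMb x hx s ⟨hs.1, hs.2.le⟩).2)
      hMi
      (by
        filter_upwards [ae_restrict_mem measurableSet_Ioi] with x hx s hs
        have h1 := qD_hasDerivAt_t df hx hs.1
        have h2 := qD_hasDerivAt_t dfx hx hs.1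
        rw [hsymm x hx s hs.1] at h2
        have h3 := (h1.pow 2).add ((h2.pow 2).const_mul α)
        refine HasDerivAt.congr_deriv (f := fun r => e r x) h3 ?_
        change ((2:ℕ):ℝ) * a (x, s) ^ 1 * c (x, s) +
          α * (((2:ℕ):ℝ) * b (x, s) ^ 1 * d (x, s)) =
          2 * (a (x, s) * c (x, s) + α * (b (x, s) * d (x, s)))
        push_cast
        ring)
    rw [hzero t ht] at this
    exact this.2
  have hElim : Tendsto E (𝓝[>] 0) (𝓝 0) := by
    obtain ⟨M, hMi, hMb⟩ := hdom 1 one_pos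
    have hs : Ioo (0:ℝ) 1 ∈ 𝓝[>] (0:ℝ) := Ioo_mem_nhdsGT one_pos
    have := tendsto_integral_filter_of_dominated_convergence (μ := volume.restrict (Ioi (0:ℝ)))
      (F := e) (f := fun _ => (0:ℝ)) (l := 𝓝[>] (0:ℝ)) M
      (by filter_upwards [hs] with s hs using emeas s hs.1.le)
      (by
        filter_upwards [hs] with s hs
        filter_upwards [ae_restrict_mem measurableSet_Ioi] with x hx
        exact (hMb x hx s ⟨hs.1, hs.2.le⟩).1)
      hMi
      (by
        filter_upwards [ae_restrict_mem measurableSet_Ioi] with x hx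
        have h1 := q_tendsto_t df.continuousOn hx
        have h2 := q_tendsto_t dfx.continuousOn hx
        rw [hx0 x hx] at h2
        rw [hinit x hx] at h1
        have h3 := (h1.pow 2).add ((h2.pow 2).const_mul α)
        simpa using h3)
    simpa using this
  have hE0 : ∀ t > (0:ℝ), E t = 0 := by
    intro t ht
    have hc : ∀ s ∈ Ioi (0:ℝ), E s = E t := fun s hs =>
      isOpen_Ioi.is_const_of_deriv_eq_zero isPreconnected_Ioi
        (fun r hr => (hEd r hr).differentiableAt.differentiableWithinAt)
        (fun r hr => (hEd r hr).deriv) hs ht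
    have h1 : Tendsto E (𝓝[>] 0) (𝓝 (E t)) := by
      refine tendsto_const_nhds.congr' ?_
      filter_upwards [self_mem_nhdsWithin] with s hs using (hc s hs).symm
    exact tendsto_nhds_unique h1 hElim
  intro x hx t ht
  have hnn : ∀ x, 0 ≤ e t x := fun x => by simp only [he]; positivity
  have h1 : e t =ᵐ[volume.restrict (Ioi 0)] 0 :=
    (integral_eq_zero_iff_of_nonneg hnn (eint t ht)).1 (hE0 t ht)
  have h2 : EqOn (e t) 0 (Ioi 0) :=
    Measure.eqOn_open_of_ae_eq h1 isOpen_Ioi (econt t ht.le) continuousOn_const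
  have h3 : a (x, t) ^ 2 + α * b (x, t) ^ 2 = 0 := h2 hx
  have h4 : 0 ≤ α * b (x, t) ^ 2 := by positivity
  have h5 : a (x, t) ^ 2 = 0 := le_antisymm (by linarith) (sq_nonneg _)
  exact pow_eq_zero_iff (two_ne_zero) |>.1 h5

theorem stmt12 (α β : ℝ) (hα : 0 < α) (hβ : 0 < β) (w : ℝ → ℝ → ℝ)
    (hreg : ContDiffOn ℝ 3 (fun p : ℝ × ℝ => w p.1 p.2)
      ((Ici (0:ℝ) ×ˢ Ici (0:ℝ)) \ {((0:ℝ), (0:ℝ))}))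
    (hpde : ∀ x > (0:ℝ), ∀ t > (0:ℝ),
      deriv (fun s => w x s) t
        - α * iteratedDeriv 2 (fun y => deriv (fun s => w y s) t) x
        + β * deriv (fun y => w y t) x = 0)
    (hinit : ∀ x > (0:ℝ), w x 0 = 0)
    (hbdry : ∀ t > (0:ℝ), w 0 t = 0)
    (hlim : ∀ t > (0:ℝ), Tendsto (fun x => w x t) atTop (𝓝 0))
    (hbd : ∀ t > (0:ℝ), ∃ C : ℝ, ∀ x ≥ (1:ℝ),
      |deriv (fun y => deriv (fun s => w y s) t) x| ≤ C)
    (hM : ∀ T > (0:ℝ), ∃ M : ℝ → ℝ, (∀ x > (0:ℝ), 0 ≤ M x) ∧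
      IntegrableOn M (Ioi (0:ℝ)) ∧
      ∀ x > (0:ℝ), ∀ t ∈ Ioc (0:ℝ) T,
        (w x t)^2 ≤ M x ∧ (deriv (fun y => w y t) x)^2 ≤ M x ∧
        (deriv (fun s => w x s) t)^2 ≤ M x ∧
        (deriv (fun y => deriv (fun s => w y s) t) x)^2 ≤ M x) :
    ∀ x > (0:ℝ), ∀ t > (0:ℝ), w x t = 0 := by
  set f : ℝ × ℝ → ℝ := fun p => w p.1 p.2 with hfdef
  have hf : ContDiffOn ℝ 3 f qS := hreg
  have hft : ContDiffOn ℝ 2 (qD (0, 1) f) qS := qD_contDiffOn (by norm_num) _ hf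
  have hftx : ContDiffOn ℝ 1 (qD (1, 0) (qD (0, 1) f)) qS := qD_contDiffOn (by norm_num) _ hft
  have df : DifferentiableOn ℝ f qS := hf.differentiableOn (by norm_num)
  have dft : DifferentiableOn ℝ (qD (0, 1) f) qS := hft.differentiableOn (by norm_num)
  have dftx : DifferentiableOn ℝ (qD (1, 0) (qD (0, 1) f)) qS := hftx.differentiableOn (by norm_num)
  have e1 : ∀ x > (0:ℝ), ∀ t > (0:ℝ), deriv (fun y => w y t) x = qD (1, 0) f (x, t) :=
    fun x hx t ht => (qD_hasDerivAt_x df hx ht.le).deriv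
  have e2 : ∀ x > (0:ℝ), ∀ t > (0:ℝ), deriv (fun s => w x s) t = qD (0, 1) f (x, t) :=
    fun x hx t ht => (qD_hasDerivAt_t df hx ht).deriv
  have e3 : ∀ x > (0:ℝ), ∀ t > (0:ℝ), deriv (fun y => deriv (fun s => w y s) t) x
      = qD (1, 0) (qD (0, 1) f) (x, t) := by
    intro x hx t ht
    rw [← (qD_hasDerivAt_x dft hx ht.le).deriv]
    apply EventuallyEq.deriv_eq
    filter_upwards [Ioi_mem_nhds hx] with y hy using e2 y hy t ht
  have e4 : ∀ x > (0:ℝ), ∀ t > (0:ℝ), iteratedDeriv 2 (fun y => deriv (fun s => w y s) t) x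
      = qD (1, 0) (qD (1, 0) (qD (0, 1) f)) (x, t) := by
    intro x hx t ht
    rw [iteratedDeriv_succ, iteratedDeriv_one, ← (qD_hasDerivAt_x dftx hx ht.le).deriv]
    apply EventuallyEq.deriv_eq
    filter_upwards [Ioi_mem_nhds hx] with y hy using e3 y hy t ht
  refine bbm_core α β hα f hf ?_ hinit hbdry hlim ?_ ?_
  · intro x hx t ht
    rw [← e2 x hx t ht, ← e4 x hx t ht, ← e1 x hx t ht]
    exact hpde x hx t ht
  · intro t ht
    obtain ⟨C, hC⟩ := hbd t ht
    refine ⟨C, fun x hx => ?_⟩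
    rw [← e3 x (lt_of_lt_of_le one_pos hx) t ht]
    exact hC x hx
  · intro T hT
    obtain ⟨M, h0, h1, h2⟩ := hM T hT
    refine ⟨M, h0, h1, fun x hx t ht => ?_⟩
    rw [← e3 x hx t ht.1, ← e2 x hx t ht.1, ← e1 x hx t ht.1]
    exact h2 x hx t ht
end

section
/- Let f : [0,∞) → ℝ be of class C² with f(0) = 0, lim_{x→∞} f(x) = 0, sup_{x ≥ 1} |f'(x)| < ∞, and suppose the product f · f'' is Lebesgue integrable on (0,∞). Then (f')² is Lebesgue integrable on (0,∞) and ∫₀^∞ f(x) f''(x) dx = −∫₀^∞ (f'(x))² dx. -/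
open MeasureTheory Filter Set Topology

theorem stmt14 (f : ℝ → ℝ) (hf : ContDiff ℝ 2 f) (h0 : f 0 = 0)
    (hlim : Tendsto f atTop (𝓝 0))
    (hbd : ∃ C : ℝ, ∀ x ≥ (1:ℝ), |deriv f x| ≤ C)
    (hint : IntegrableOn (fun x => f x * iteratedDeriv 2 f x) (Ioi (0:ℝ))) :
    IntegrableOn (fun x => (deriv f x)^2) (Ioi (0:ℝ)) ∧
    ∫ x in Ioi (0:ℝ), f x * iteratedDeriv 2 f x
      = -∫ x in Ioi (0:ℝ), (deriv f x)^2 := by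
  obtain ⟨C, hC⟩ := hbd
  have e2 : iteratedDeriv 2 f = deriv (deriv f) := by
    rw [iteratedDeriv_succ, iteratedDeriv_one]
  have c2 : Continuous (iteratedDeriv 2 f) := hf.continuous_iteratedDeriv 2 le_rfl
  have c1 : Continuous (deriv f) := hf.continuous_deriv (by norm_num)
  have d1 : ∀ x, HasDerivAt f (deriv f x) x := fun x =>
    (hf.differentiable (by norm_num) x).hasDerivAt
  have d2 : ∀ x, HasDerivAt (deriv f) (iteratedDeriv 2 f x) x := fun x => by
    have h := hf.differentiable_iteratedDeriv 1 (by norm_num)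
    rw [iteratedDeriv_one] at h
    rw [e2]
    exact (h x).hasDerivAt
  have key : ∀ A : ℝ, ∫ x in (0:ℝ)..A, (deriv f x)^2
      = f A * deriv f A - ∫ x in (0:ℝ)..A, f x * iteratedDeriv 2 f x := by
    intro A
    have h := intervalIntegral.integral_mul_deriv_eq_deriv_mul (a := 0) (b := A)
      (fun x _ => d1 x) (fun x _ => d2 x)
      (c1.intervalIntegrable _ _) (c2.intervalIntegrable _ _)
    rw [h, h0]
    simp only [pow_two]
    ring
  have hb : Tendsto (fun A => f A * deriv f A) atTop (𝓝 0) := by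
    have hz : Tendsto (fun A => |f A| * C) atTop (𝓝 0) := by
      simpa using hlim.abs.mul_const C
    refine squeeze_zero_norm' ?_ hz
    filter_upwards [eventually_ge_atTop (1:ℝ)] with x hx
    rw [norm_mul, Real.norm_eq_abs, Real.norm_eq_abs]
    exact mul_le_mul_of_nonneg_left (hC x hx) (abs_nonneg _)
  have ht : Tendsto (fun A : ℝ => ∫ x in (0:ℝ)..A, (deriv f x)^2) atTop
      (𝓝 (0 - ∫ x in Ioi (0:ℝ), f x * iteratedDeriv 2 f x)) := by
    simp only [key]
    exact hb.sub (intervalIntegral_tendsto_integral_Ioi 0 hint tendsto_id)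
  have hi : IntegrableOn (fun x => (deriv f x)^2) (Ioi (0:ℝ)) := by
    refine integrableOn_Ioi_of_intervalIntegral_norm_tendsto _ 0 (fun A => ?_) tendsto_id
      (by simpa using ht)
    exact (c1.pow 2).integrableOn_Ioc
  refine ⟨hi, ?_⟩
  have := tendsto_nhds_unique ht (intervalIntegral_tendsto_integral_Ioi 0 hi tendsto_id)
  linarith
end

section
/- Let α > 0, β > 0, let A, B be real numbers with B ≠ 0, and let ξ be a real-valued function of class C³ on [0,∞)×[0,∞) satisfying: (i) ξ_t − α ξ_{xxt} + β ξ_x = 0 on Q; (ii) A ξ(x,t) + B ξ_x(x,t) = 0 for all (x,t) ∈ Q; (iii) ξ(x,0) = 0 for all x > 0. Then ξ ≡ 0 on Q. (Hence uniqueness for the Robin problem for the linearized BBM equation reduces to uniqueness for the Dirichlet problem.) -/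
open MeasureTheory Filter Set Topology

theorem stmt17 (α β A B : ℝ) (hα : 0 < α) (hβ : 0 < β) (hB : B ≠ 0)
    (ξ : ℝ → ℝ → ℝ)
    (hreg : ContDiffOn ℝ 3 (fun p : ℝ × ℝ => ξ p.1 p.2) (Ici (0:ℝ) ×ˢ Ici (0:ℝ)))
    (hpde : ∀ x > (0:ℝ), ∀ t > (0:ℝ),
      deriv (fun s => ξ x s) t
        - α * iteratedDeriv 2 (fun y => deriv (fun s => ξ y s) t) x
        + β * deriv (fun y => ξ y t) x = 0)
    (hrel : ∀ x > (0:ℝ), ∀ t > (0:ℝ),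
      A * ξ x t + B * deriv (fun y => ξ y t) x = 0)
    (hinit : ∀ x > (0:ℝ), ξ x 0 = 0) :
    ∀ x > (0:ℝ), ∀ t > (0:ℝ), ξ x t = 0 := by
  obtain ⟨k, hk⟩ : ∃ k, k = A / B := ⟨_, rfl⟩
  have hA : A = k * B := by rw [hk]; field_simp
  have hdiff : ∀ x > (0:ℝ), ∀ t > (0:ℝ),
      DifferentiableAt ℝ (fun p : ℝ × ℝ => ξ p.1 p.2) (x, t) := by
    intro x hx t ht
    exact (hreg.contDiffAt (prod_mem_nhds (Ici_mem_nhds hx) (Ici_mem_nhds ht))).differentiableAt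
      (by norm_num)
  have hdx : ∀ x > (0:ℝ), ∀ t > (0:ℝ), DifferentiableAt ℝ (fun y => ξ y t) x := by
    intro x hx t ht
    exact DifferentiableAt.comp (f := fun y : ℝ => (y, t)) x (hdiff x hx t ht) (by fun_prop)
  have hdt : ∀ x > (0:ℝ), ∀ t > (0:ℝ), DifferentiableAt ℝ (fun s => ξ x s) t := by
    intro x hx t ht
    exact DifferentiableAt.comp (f := fun s : ℝ => (x, s)) t (hdiff x hx t ht) (by fun_prop)
  have hx' : ∀ x > (0:ℝ), ∀ t > (0:ℝ), deriv (fun y => ξ y t) x = - k * ξ x t := by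
    intro x hx t ht
    have := hrel x hx t ht
    rw [hA] at this
    apply mul_left_cancel₀ hB
    linarith
  -- separation of variables
  have hsep : ∀ x > (0:ℝ), ∀ t > (0:ℝ),
      ξ x t = (ξ 1 t * Real.exp k) * Real.exp (-k * x) := by
    intro x hx t ht
    have hd : ∀ y ∈ Ioi (0:ℝ), HasDerivAt (fun y => ξ y t * Real.exp (k * y)) 0 y := by
      intro y hy
      have h1 := (hdx y hy t ht).hasDerivAt
      rw [hx' y hy t ht] at h1
      have h2 : HasDerivAt (fun y => Real.exp (k * y)) (Real.exp (k * y) * (k * 1)) y :=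
        ((hasDerivAt_id y).const_mul k).exp
      exact (h1.mul h2).congr_deriv (by ring)
    have hc := isOpen_Ioi.is_const_of_deriv_eq_zero (isPreconnected_Ioi (a := (0:ℝ)))
      (fun y hy => (hd y hy).differentiableAt.differentiableWithinAt)
      (fun y hy => (hd y hy).deriv) (show x ∈ Ioi (0:ℝ) from hx)
      (show (1:ℝ) ∈ Ioi (0:ℝ) from mem_Ioi.2 one_pos)
    simp only [mul_one] at hc
    rw [← hc, mul_assoc, ← Real.exp_add]
    simp
  have hexp : ∀ x : ℝ, HasDerivAt (fun y => Real.exp (-k * y)) (-k * Real.exp (-k * x)) x := by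
    intro x
    have := ((hasDerivAt_id x).const_mul (-k)).exp
    exact this.congr_deriv (by simp only [id]; ring)
  have hode : ∀ t > (0:ℝ),
      (1 - α * k ^ 2) * deriv (fun s => ξ 1 s) t - β * k * ξ 1 t = 0 := by
    intro t ht
    set D := deriv (fun s => ξ 1 s) t with hD
    have hξt : ∀ y > (0:ℝ), deriv (fun s => ξ y s) t
        = (D * Real.exp k) * Real.exp (-k * y) := by
      intro y hy
      have he : (fun s => ξ y s) =ᶠ[𝓝 t] fun s => (ξ 1 s * Real.exp k) * Real.exp (-k * y) := by
        filter_upwards [Ioi_mem_nhds ht] with s hs using hsep y hy s hs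
      rw [he.deriv_eq]
      exact (((hdt 1 one_pos t ht).hasDerivAt.mul_const _).mul_const _).deriv
    have h2 : iteratedDeriv 2 (fun y => deriv (fun s => ξ y s) t) 1
        = k ^ 2 * ((D * Real.exp k) * Real.exp (-k * 1)) := by
      have he : (fun y => deriv (fun s => ξ y s) t) =ᶠ[𝓝 1]
          fun y => (D * Real.exp k) * Real.exp (-k * y) := by
        filter_upwards [Ioi_mem_nhds one_pos] with s hs using hξt s hs
      rw [iteratedDeriv_succ, iteratedDeriv_one, he.deriv.deriv_eq]
      have : deriv (fun y => (D * Real.exp k) * Real.exp (-k * y))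
          = fun y => (D * Real.exp k) * (-k * Real.exp (-k * y)) := by
        funext y
        exact ((hexp y).const_mul _).deriv
      rw [this, (((hexp 1).const_mul (-k)).const_mul _).deriv]
      ring
    have hp := hpde 1 one_pos t ht
    rw [h2, hx' 1 one_pos t ht, mul_assoc D, ← Real.exp_add] at hp
    simp only [mul_one, add_neg_cancel, Real.exp_zero] at hp
    rw [← hD] at hp
    linarith
  have hφ : ∀ t > (0:ℝ), ξ 1 t = 0 := by
    intro t ht
    by_cases hc : 1 - α * k ^ 2 = 0
    · have hk0 : k ≠ 0 := by
        rintro rfl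
        norm_num at hc
      have := hode t ht
      rw [hc] at this
      have h3 : β * k * ξ 1 t = 0 := by linarith
      exact (mul_eq_zero.1 h3).resolve_left (mul_ne_zero hβ.ne' hk0)
    · obtain ⟨c, hcd⟩ : ∃ c, c = β * k / (1 - α * k ^ 2) := ⟨_, rfl⟩
      have hD : ∀ s > (0:ℝ), deriv (fun s => ξ 1 s) s = c * ξ 1 s := by
        intro s hs
        have := hode s hs
        rw [hcd]
        rw [div_mul_eq_mul_div, eq_div_iff hc]
        linarith
      have hcont : ContinuousOn (fun s => ξ 1 s) (Icc 0 t) := by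
        refine hreg.continuousOn.comp (f := fun s : ℝ => ((1:ℝ), s)) (by fun_prop) ?_
        intro s hs
        exact ⟨zero_le_one (α := ℝ), hs.1⟩
      have hd : ∀ s ∈ Ioo 0 t, HasDerivAt (fun s => ξ 1 s * Real.exp (-c * s)) 0 s := by
        intro s hs
        have h1 := (hdt 1 one_pos s hs.1).hasDerivAt
        rw [hD s hs.1] at h1
        have h2 : HasDerivAt (fun y => Real.exp (-c * y)) (Real.exp (-c * s) * (-c * 1)) s :=
          ((hasDerivAt_id s).const_mul (-c)).exp
        exact (h1.mul h2).congr_deriv (by ring)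
      obtain ⟨s, hs, h⟩ := exists_hasDerivAt_eq_slope
        (fun s => ξ 1 s * Real.exp (-c * s)) (fun _ => 0) ht
        (hcont.mul (by fun_prop)) hd
      rw [hinit 1 one_pos] at h
      have := ht.ne'
      have := Real.exp_ne_zero (-c * t)
      simp only [zero_mul, sub_zero] at h
      have h4 := h.symm
      rw [div_eq_zero_iff, mul_eq_zero] at h4
      tauto
  intro x hx t ht
  rw [hsep x hx t ht, hφ t ht]
  simp
end

section
/- Let A, B, C be positive real numbers and let ξ be a real-valued function of class C² on [0,∞)×[0,∞) satisfying: (i) the heat equation ξ_t = ξ_{xx} on Q; (ii) the oblique relation A ξ(x,t) + B ξ_x(x,t) + C ξ_t(x,t) = 0 for all (x,t) ∈ Q; (iii) ξ(x,0) = 0 for all x > 0. Then ξ ≡ 0 on Q. (Hence uniqueness for the oblique Robin problem for the heat equation on the half-line reduces to uniqueness for the Dirichlet problem.) -/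
open MeasureTheory Filter Set Topology

theorem stmt18 (A B C : ℝ) (hA : 0 < A) (hB : 0 < B) (hC : 0 < C)
    (ξ : ℝ → ℝ → ℝ)
    (hreg : ContDiffOn ℝ 2 (fun p : ℝ × ℝ => ξ p.1 p.2) (Ici (0:ℝ) ×ˢ Ici (0:ℝ)))
    (hpde : ∀ x > (0:ℝ), ∀ t > (0:ℝ),
      deriv (fun s => ξ x s) t = iteratedDeriv 2 (fun y => ξ y t) x)
    (hrel : ∀ x > (0:ℝ), ∀ t > (0:ℝ),
      A * ξ x t + B * deriv (fun y => ξ y t) x + C * deriv (fun s => ξ x s) t = 0)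
    (hinit : ∀ x > (0:ℝ), ξ x 0 = 0) :
    ∀ x > (0:ℝ), ∀ t > (0:ℝ), ξ x t = 0 := by
  have hcd : ∀ x > (0:ℝ), ∀ t > (0:ℝ),
      ContDiffAt ℝ 2 (fun p : ℝ × ℝ => ξ p.1 p.2) (x, t) := by
    intro x hx t ht
    exact hreg.contDiffAt (prod_mem_nhds (Ici_mem_nhds hx) (Ici_mem_nhds ht))
  -- vanishing beyond the characteristic through the origin
  have hfar : ∀ t > (0:ℝ), ∀ x > B * (t / C), ξ x t = 0 := by
    intro t ht x hx
    have htC : 0 < t / C := div_pos ht hC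
    set x0 := x - B * (t / C) with hx0
    have hx0p : 0 < x0 := by linarith
    let h : ℝ → ℝ := fun s => ξ (x0 + B * s) (C * s) * Real.exp (A * s)
    have hcont : ContinuousOn h (Icc 0 (t / C)) := by
      have h1 : ContinuousOn (fun s : ℝ => (fun p : ℝ × ℝ => ξ p.1 p.2) (x0 + B * s, C * s))
          (Icc 0 (t / C)) := by
        refine hreg.continuousOn.comp (by fun_prop) ?_
        intro s hs
        have := hs.1
        refine ⟨?_, ?_⟩ <;> simp only [mem_Ici] <;> positivity
      exact h1.mul (by fun_prop)
    have hder : ∀ s ∈ Ioo 0 (t / C), HasDerivAt h 0 s := by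
      intro s hs
      have hs0 := hs.1
      have hX : 0 < x0 + B * s := by positivity
      have hT : 0 < C * s := by positivity
      have hF := ((hcd _ hX _ hT).differentiableAt (by norm_num)).hasFDerivAt
      set L := fderiv ℝ (fun p : ℝ × ℝ => ξ p.1 p.2) (x0 + B * s, C * s)
      have hdx : HasDerivAt (fun y => ξ y (C * s)) (L (1, 0)) (x0 + B * s) :=
        hF.comp_hasDerivAt (f := fun y : ℝ => (y, C * s)) _
          ((hasDerivAt_id _).prodMk (hasDerivAt_const _ _))
      have hdt : HasDerivAt (fun r => ξ (x0 + B * s) r) (L (0, 1)) (C * s) :=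
        hF.comp_hasDerivAt (f := fun r : ℝ => (x0 + B * s, r)) _
          ((hasDerivAt_const _ _).prodMk (hasDerivAt_id _))
      have hr := hrel _ hX _ hT
      rw [hdx.deriv, hdt.deriv] at hr
      have hc : HasDerivAt (fun r : ℝ => (x0 + B * r, C * r)) (B, C) s := by
        have a1 : HasDerivAt (fun r : ℝ => x0 + B * r) B s := by
          simpa using ((hasDerivAt_id s).const_mul B).const_add x0
        have a2 : HasDerivAt (fun r : ℝ => C * r) C s := by
          simpa using (hasDerivAt_id s).const_mul C
        exact a1.prodMk a2
      have hd : HasDerivAt (fun r : ℝ => ξ (x0 + B * r) (C * r)) (L (B, C)) s :=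
        hF.comp_hasDerivAt (f := fun r : ℝ => (x0 + B * r, C * r)) _ hc
      have hL : L (B, C) = B * L (1, 0) + C * L (0, 1) := by
        have : ((B, C) : ℝ × ℝ) = B • ((1, 0) : ℝ × ℝ) + C • ((0, 1) : ℝ × ℝ) := by simp
        rw [this, map_add, map_smul, map_smul]; rfl
      have he : HasDerivAt (fun r : ℝ => Real.exp (A * r)) (Real.exp (A * s) * A) s := by
        have a2 : HasDerivAt (fun r : ℝ => A * r) A s := by
          simpa using (hasDerivAt_id s).const_mul A
        exact a2.exp
      refine (hd.mul he).congr_deriv ?_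
      rw [hL]
      linear_combination (Real.exp (A * s)) * hr
    obtain ⟨c, hc, hslope⟩ := exists_hasDerivAt_eq_slope h (fun _ => 0) htC hcont hder
    have hh0 : h 0 = 0 := by simp [h, hinit x0 hx0p]
    have hh1 : h (t / C) = 0 := by
      rw [hh0, eq_comm, div_eq_zero_iff] at hslope
      rcases hslope with h1 | h1 <;> linarith
    have e1 : x0 + B * (t / C) = x := by rw [hx0]; ring
    have e2 : C * (t / C) = t := by field_simp
    simp only [h, e1, e2] at hh1
    exact (mul_eq_zero.mp hh1).resolve_right (Real.exp_pos _).ne'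
  intro x hx t ht
  set g : ℝ → ℝ := fun y => ξ y t with hg
  have hgc : ∀ y > 0, ContDiffAt ℝ 2 g y := by
    intro y hy
    exact (hcd y hy t ht).comp (f := fun y : ℝ => (y, t)) y (by fun_prop)
  have hg1 : ∀ y > 0, HasDerivAt g (deriv g y) y := fun y hy =>
    ((hgc y hy).differentiableAt (by norm_num)).hasDerivAt
  have hg2 : ∀ y > 0, HasDerivAt (deriv g) (-(A * g y + B * deriv g y) / C) y := by
    intro y hy
    have hd : DifferentiableAt ℝ (deriv g) y := by
      have h1 : ContDiffAt ℝ 1 (deriv g) y := ContDiffAt.derivWithin (hgc y hy) (by norm_num)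
      exact h1.differentiableAt (by norm_num)
    have e : deriv (deriv g) y = -(A * g y + B * deriv g y) / C := by
      have h1 := hpde y hy t ht
      have h2 := hrel y hy t ht
      rw [h1, iteratedDeriv_succ, iteratedDeriv_one] at h2
      rw [eq_div_iff hC.ne']
      simp only [hg]
      linarith
    rw [← e]; exact hd.hasDerivAt
  have hBt : 0 < B * (t / C) := by positivity
  set y0 := x + B * (t / C) with hy0
  have hev : g =ᶠ[𝓝 y0] fun _ => 0 := by
    filter_upwards [Ioi_mem_nhds (show B * (t / C) < y0 by linarith)] with y hy
    exact hfar t ht y hy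
  let L : ℝ × ℝ →L[ℝ] ℝ × ℝ :=
    (ContinuousLinearMap.snd ℝ ℝ ℝ).prod
      ((-1 / C) • (A • ContinuousLinearMap.fst ℝ ℝ ℝ + B • ContinuousLinearMap.snd ℝ ℝ ℝ))
  have key := ODE_solution_unique_of_mem_Ioo (v := fun _ => L) (s := fun _ => univ)
    (K := ‖L‖₊) (f := fun y => (g y, deriv g y)) (g := fun _ => (0 : ℝ × ℝ))
    (a := 0) (b := y0 + 1) (t₀ := y0)
    (fun _ _ => L.lipschitz.lipschitzOnWith) ⟨by linarith, by linarith⟩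
    (by
      intro y hy
      refine ⟨?_, mem_univ _⟩
      refine ((hg1 y hy.1).prodMk (hg2 y hy.1)).congr_deriv ?_
      refine Prod.ext ?_ ?_
      · simp [L]
      · simp [L]; ring)
    (by
      intro y hy
      refine ⟨?_, mem_univ _⟩
      simpa using hasDerivAt_const y (0 : ℝ × ℝ))
    (by
      have := hev.deriv_eq
      have h2 := hev.eq_of_nhds
      simp only [this, h2]; simp)
  have := key (show x ∈ Ioo 0 (y0 + 1) from ⟨hx, by linarith⟩)
  exact congrArg Prod.fst this
end

section
/- Let g₀ ∈ C^∞([0,∞)) be complex-valued, let γ be the contour consisting of the ray {s e^{3iπ/4} : s ≥ 0} traversed from infinity to 0 followed by the ray {s e^{iπ/4} : s ≥ 0} traversed from 0 to infinity, and set g̃₀(λ,t) := ∫₀^t e^{λ²τ} g₀(τ) dτ. Define H(x,t) := ∫_γ e^{iλx − λ²t} λ g̃₀(λ,t) dλ for (x,t) ∈ Q. Then H is smooth on Q, and for all nonnegative integers k, m, ℓ and every T₀ > 0, x^ℓ · ∂^{k+m} H/∂x^k ∂t^m (x,t) → 0 as x → +∞, uniformly for 0 < t ≤ T₀. -/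
open MeasureTheory Filter Set Topology

/-- `g̃₀(λ,t) = ∫₀^t e^{λ²τ} g₀(τ) dτ`. -/
noncomputable def gTildeHeat (g₀ : ℝ → ℂ) (l : ℂ) (t : ℝ) : ℂ :=
  ∫ τ in (0:ℝ)..t, Complex.exp (l^2 * (τ:ℂ)) * g₀ τ

/-- The integrand `e^{iλx − λ²t} λ g̃₀(λ,t)`. -/
noncomputable def FgammaHeat (g₀ : ℝ → ℂ) (x t : ℝ) (l : ℂ) : ℂ :=
  Complex.exp (Complex.I * l * (x:ℂ) - l^2 * (t:ℂ)) * l * gTildeHeat g₀ l t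

/-- `H(x,t) = ∫_γ e^{iλx − λ²t} λ g̃₀(λ,t) dλ`, where `γ` consists of the ray
`{s e^{3iπ/4} : s ≥ 0}` from infinity to `0` followed by the ray `{s e^{iπ/4} : s ≥ 0}`
from `0` to infinity:
`∫_γ F dλ = ∫₀^∞ F(s e^{iπ/4}) e^{iπ/4} ds − ∫₀^∞ F(s e^{3iπ/4}) e^{3iπ/4} ds`. -/
noncomputable def Hheat (g₀ : ℝ → ℂ) (x t : ℝ) : ℂ :=
  (∫ s in Ioi (0:ℝ),
      FgammaHeat g₀ x t ((s:ℂ) * Complex.exp (Complex.I * (Real.pi:ℂ) / 4))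
        * Complex.exp (Complex.I * (Real.pi:ℂ) / 4))
  - (∫ s in Ioi (0:ℝ),
      FgammaHeat g₀ x t ((s:ℂ) * Complex.exp (3 * Complex.I * (Real.pi:ℂ) / 4))
        * Complex.exp (3 * Complex.I * (Real.pi:ℂ) / 4))


noncomputable def Eh (g : ℝ → ℂ) (z : ℂ) (t : ℝ) : ℂ :=
  Complex.exp (-(z * (t:ℂ))) * ∫ τ in (0:ℝ)..t, Complex.exp (z * (τ:ℂ)) * g τ

lemma Eh_hasDerivAt {g : ℝ → ℂ} (hg : Continuous g) (z : ℂ) (t : ℝ) :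
    HasDerivAt (Eh g z) (-(z * Eh g z t) + g t) t := by
  have hc : Continuous (fun τ : ℝ => Complex.exp (z * (τ:ℂ)) * g τ) := by fun_prop
  have h1 : HasDerivAt (fun t : ℝ => ∫ τ in (0:ℝ)..t, Complex.exp (z * (τ:ℂ)) * g τ)
      (Complex.exp (z * (t:ℂ)) * g t) t :=
    intervalIntegral.integral_hasDerivAt_right (hc.intervalIntegrable _ _)
      (hc.stronglyMeasurableAtFilter _ _) hc.continuousAt
  have h2 : HasDerivAt (fun t : ℝ => Complex.exp (-(z * (t:ℂ))))
      (Complex.exp (-(z * (t:ℂ))) * (-(z * 1))) t :=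
    (((hasDerivAt_id t).ofReal_comp.const_mul z).neg).cexp
  have h3 := h2.mul h1
  refine h3.congr_deriv ?_
  have : Complex.exp (-(z * (t:ℂ))) * Complex.exp (z * (t:ℂ)) = 1 := by
    rw [← Complex.exp_add]; simp
  unfold Eh
  linear_combination g t * this

lemma Eh_bound {g : ℝ → ℂ} (z : ℂ) (hz : z.re = 0) (t M : ℝ)
    (hM : ∀ τ ∈ uIoc (0:ℝ) t, ‖g τ‖ ≤ M) : ‖Eh g z t‖ ≤ M * |t| := by
  have h := intervalIntegral.norm_integral_le_of_norm_le_const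
    (f := fun τ : ℝ => Complex.exp (z * (τ:ℂ)) * g τ) (a := 0) (b := t) (C := M) (by
      intro τ hτ
      rw [norm_mul, Complex.norm_exp]
      simpa [hz] using hM τ hτ)
  unfold Eh
  rw [norm_mul, Complex.norm_exp]
  simpa [hz] using h

lemma Eh_continuous {g : ℝ → ℂ} (hg : Continuous g) (w : ℂ) (t : ℝ) :
    Continuous (fun s : ℝ => Eh g (((s:ℂ) * w)^2) t) := by
  unfold Eh
  refine Continuous.mul (by fun_prop) ?_
  exact intervalIntegral.continuous_parametric_intervalIntegral_of_continuous' (by fun_prop) _ _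

noncomputable def rayF (g : ℝ → ℂ) (w : ℂ) (n : ℕ) (s x t : ℝ) : ℂ :=
  ((s:ℂ) * w)^n * Complex.exp (Complex.I * ((s:ℂ) * w) * (x:ℂ)) * Eh g (((s:ℂ) * w)^2) t * w

noncomputable def rayB (w : ℂ) (n : ℕ) (s x : ℝ) : ℂ :=
  ((s:ℂ) * w)^n * Complex.exp (Complex.I * ((s:ℂ) * w) * (x:ℂ)) * w

lemma rayF_eq (g : ℝ → ℂ) (w : ℂ) (n : ℕ) (s x t : ℝ) :
    rayF g w n s x t = rayB w n s x * Eh g (((s:ℂ) * w)^2) t := by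
  unfold rayF rayB; ring

structure GoodDir (w : ℂ) : Prop where
  norm_eq : ‖w‖ = 1
  sq_re : (w^2).re = 0
  im_pos : 0 < w.im

lemma GoodDir.sre {w : ℂ} (hw : GoodDir w) (s : ℝ) : (((s:ℂ) * w)^2).re = 0 := by
  have : ((s:ℂ) * w)^2 = ((s^2 : ℝ) : ℂ) * w^2 := by push_cast; ring
  rw [this, Complex.re_ofReal_mul, hw.sq_re, mul_zero]

lemma rayB_norm {w : ℂ} (hw : GoodDir w) (n : ℕ) {s : ℝ} (hs : 0 < s) (x : ℝ) :
    ‖rayB w n s x‖ = s^n * Real.exp (-(w.im * x * s)) := by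
  unfold rayB
  rw [norm_mul, norm_mul, norm_pow, norm_mul, hw.norm_eq, Complex.norm_exp]
  have : (Complex.I * ((s:ℂ) * w) * (x:ℂ)).re = -(w.im * x * s) := by
    simp; ring
  rw [this]; simp [abs_of_pos hs]

lemma pe_integrable (n : ℕ) {b : ℝ} (hb : 0 < b) :
    IntegrableOn (fun s : ℝ => s^n * Real.exp (-(b * s))) (Ioi 0) := by
  have := integrableOn_rpow_mul_exp_neg_mul_rpow (p := 1) (s := (n:ℝ)) (b := b)
    (by have : (0:ℝ) ≤ n := n.cast_nonneg
        linarith) one_pos hb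
  simpa [Real.rpow_natCast] using this

lemma pe_integral (n : ℕ) {b : ℝ} (hb : 0 < b) :
    ∫ s in Ioi (0:ℝ), s^n * Real.exp (-(b * s)) = (1/b)^(n+1) * (n.factorial : ℝ) := by
  have := Real.integral_rpow_mul_exp_neg_mul_Ioi (a := (n:ℝ)+1) (r := b) (by positivity) hb
  rw [Real.Gamma_nat_eq_factorial] at this
  rw [← Real.rpow_natCast (1/b) (n+1)]
  push_cast
  rw [← this]
  simp [Real.rpow_natCast]

lemma rayB_cont (w : ℂ) (n : ℕ) (x : ℝ) : Continuous (fun s : ℝ => rayB w n s x) := by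
  unfold rayB; fun_prop

lemma rayB_integrable {w : ℂ} (hw : GoodDir w) (n : ℕ) {x : ℝ} (hx : 0 < x) :
    IntegrableOn (fun s : ℝ => rayB w n s x) (Ioi 0) := by
  refine (pe_integrable n (mul_pos hw.im_pos hx)).mono' (rayB_cont w n x).aestronglyMeasurable ?_
  refine (ae_restrict_mem measurableSet_Ioi).mono fun s hs => ?_
  exact (rayB_norm hw n hs x).le

lemma ray_ftc {w : ℂ} (hw : GoodDir w) (n : ℕ) {x : ℝ} (hx : 0 < x) {f' : ℝ → ℂ}
    (hd : ∀ s : ℝ, HasDerivAt (fun s : ℝ => rayB w n s x) (f' s) s)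
    (hi : IntegrableOn f' (Ioi 0)) : ∫ s in Ioi (0:ℝ), f' s = - rayB w n 0 x := by
  have h0 := tendsto_zero_of_hasDerivAt_of_integrableOn_Ioi (a := 0) (fun s _ => hd s) hi
    (rayB_integrable hw n hx)
  have := integral_Ioi_of_hasDerivAt_of_tendsto' (a := 0) (fun s _ => hd s) hi h0
  rw [this, zero_sub]

lemma rayB_integral {w : ℂ} (hw : GoodDir w) (n : ℕ) {x : ℝ} (hx : 0 < x) :
    ∫ s in Ioi (0:ℝ), rayB w n s x = (1/(-Complex.I * x))^(n+1) * (n.factorial : ℂ) := by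
  have hw0 : w ≠ 0 := by
    intro h; have := hw.im_pos; simp [h] at this
  have hxc : (x:ℂ) ≠ 0 := by exact_mod_cast hx.ne'
  have hI := Complex.I_ne_zero
  have hexp : ∀ s : ℝ, HasDerivAt (fun s : ℝ => Complex.exp (Complex.I * ((s:ℂ) * w) * (x:ℂ)))
      (Complex.exp (Complex.I * ((s:ℂ) * w) * (x:ℂ)) * (Complex.I * (1 * w) * (x:ℂ))) s := fun s =>
    ((((hasDerivAt_id s).ofReal_comp.mul_const w).const_mul Complex.I).mul_const (x:ℂ)).cexp
  induction n with
  | zero =>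
    have h := ray_ftc hw 0 hx (f' := fun s => (w * Complex.I * x) * rayB w 0 s x) (fun s => by
      have h1 := (hexp s).mul_const w
      have e : (fun s : ℝ => rayB w 0 s x) =
          fun s : ℝ => Complex.exp (Complex.I * ((s:ℂ) * w) * (x:ℂ)) * w := by
        ext s; simp [rayB]
      rw [e]
      refine h1.congr_deriv ?_
      unfold rayB; ring) ((rayB_integrable hw 0 hx).const_mul _)
    rw [integral_const_mul] at h
    have e0 : rayB w 0 0 x = w := by simp [rayB]
    rw [e0] at h
    have : w * (Complex.I * x * (∫ s in Ioi (0:ℝ), rayB w 0 s x)) = w * (-1) := by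
      linear_combination h
    have := mul_left_cancel₀ hw0 this
    simp only [zero_add, pow_one, Nat.factorial_zero, Nat.cast_one, mul_one]
    rw [eq_div_iff (by simp [hxc])]
    linear_combination -this
  | succ n ih =>
    have i1 := (rayB_integrable hw n hx).const_mul (w * ((n:ℂ)+1))
    have i2 := (rayB_integrable hw (n+1) hx).const_mul (w * Complex.I * x)
    have h := ray_ftc hw (n+1) hx (f' := fun s => (w * ((n:ℂ)+1)) * rayB w n s x +
        (w * Complex.I * x) * rayB w (n+1) s x) (fun s => by
      have hp : HasDerivAt (fun s : ℝ => ((s:ℂ) * w)^(n+1)) _ s :=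
        ((hasDerivAt_id s).ofReal_comp.mul_const w).pow (n+1)
      refine ((hp.mul (hexp s)).mul_const w).congr_deriv ?_
      unfold rayB
      simp
      ring) (i1.add i2)
    rw [integral_add i1 i2, integral_const_mul, integral_const_mul, ih] at h
    have e0 : rayB w (n+1) 0 x = 0 := by simp [rayB]
    rw [e0] at h
    set J := ∫ s in Ioi (0:ℝ), rayB w (n+1) s x
    set K := (1/(-Complex.I * (x:ℂ)))^(n+1) * (n.factorial : ℂ) with hK
    have : w * (((n:ℂ)+1) * K + Complex.I * x * J) = w * 0 := by
      linear_combination h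
    have := mul_left_cancel₀ hw0 this
    have h3 : (1/(-Complex.I * (x:ℂ)))^(n+1+1) * ((n+1).factorial : ℂ)
        = 1/(-Complex.I * (x:ℂ)) * (((n:ℂ)+1) * K) := by
      rw [hK, Nat.factorial_succ]; push_cast; ring
    rw [h3, one_div, ← div_eq_inv_mul, eq_div_iff (by simp [hxc])]
    linear_combination -this

lemma rayF_cont {g : ℝ → ℂ} (hg : Continuous g) (w : ℂ) (n : ℕ) (x t : ℝ) :
    Continuous (fun s : ℝ => rayF g w n s x t) := by
  simp only [rayF_eq]
  exact (rayB_cont w n x).mul (Eh_continuous hg w t)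

lemma rayF_norm {g : ℝ → ℂ} {w : ℂ} (hw : GoodDir w) (n : ℕ) {s : ℝ} (hs : 0 < s)
    (x t M : ℝ) (hM : ∀ τ ∈ uIoc (0:ℝ) t, ‖g τ‖ ≤ M) :
    ‖rayF g w n s x t‖ ≤ M * |t| * (s^n * Real.exp (-(w.im * x * s))) := by
  rw [rayF_eq, norm_mul, rayB_norm hw n hs, mul_comm]
  exact mul_le_mul_of_nonneg_right (Eh_bound _ (hw.sre s) t M hM) (by positivity)

lemma exists_bound {g : ℝ → ℂ} (hg : Continuous g) (R : ℝ) :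
    ∃ M, 0 ≤ M ∧ ∀ τ ∈ Icc (-R) R, ‖g τ‖ ≤ M := by
  obtain ⟨M, hM⟩ := isCompact_Icc.exists_bound_of_continuousOn (s := Icc (-R) R) hg.continuousOn
  exact ⟨max M 0, le_max_right _ _, fun τ hτ => (hM τ hτ).trans (le_max_left _ _)⟩

lemma uIoc_sub {R t : ℝ} (ht : |t| ≤ R) : uIoc (0:ℝ) t ⊆ Icc (-R) R := by
  have := abs_le.1 ht
  intro τ hτ
  rcases le_total 0 t with h | h
  · rw [uIoc_of_le h] at hτ
    exact ⟨by linarith [hτ.1], by linarith [hτ.2]⟩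
  · rw [uIoc_of_ge h] at hτ
    exact ⟨by linarith [hτ.1], by linarith [hτ.2]⟩

lemma rayF_integrable {g : ℝ → ℂ} (hg : Continuous g) {w : ℂ} (hw : GoodDir w) (n : ℕ)
    {x : ℝ} (hx : 0 < x) (t : ℝ) :
    IntegrableOn (fun s : ℝ => rayF g w n s x t) (Ioi 0) := by
  obtain ⟨M, -, hM⟩ := exists_bound hg |t|
  refine ((pe_integrable n (mul_pos hw.im_pos hx)).const_mul (M * |t|)).mono'
    (rayF_cont hg w n x t).aestronglyMeasurable ?_
  refine (ae_restrict_mem measurableSet_Ioi).mono fun s hs => ?_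
  exact rayF_norm hw n hs x t M fun τ hτ => hM τ (uIoc_sub le_rfl hτ)

noncomputable def rayA (g : ℝ → ℂ) (w : ℂ) (n : ℕ) (x t : ℝ) : ℂ :=
  ∫ s in Ioi (0:ℝ), rayF g w n s x t

lemma rayA_bound {g : ℝ → ℂ} {w : ℂ} (hw : GoodDir w) (n : ℕ)
    {x : ℝ} (hx : 0 < x) (t M : ℝ) (hM : ∀ τ ∈ uIoc (0:ℝ) t, ‖g τ‖ ≤ M) :
    ‖rayA g w n x t‖ ≤ M * |t| * ((1/(w.im * x))^(n+1) * (n.factorial : ℝ)) := by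
  have hb := mul_pos hw.im_pos hx
  rw [← pe_integral n hb, ← integral_const_mul]
  refine norm_integral_le_of_norm_le ((pe_integrable n hb).const_mul (M * |t|)) ?_
  refine (ae_restrict_mem measurableSet_Ioi).mono fun s hs => ?_
  exact rayF_norm hw n hs x t M hM

noncomputable def Lx : ℂ →L[ℝ] (ℝ × ℝ →L[ℝ] ℂ) :=
  ContinuousLinearMap.smulRightL ℝ (ℝ × ℝ) ℂ (ContinuousLinearMap.fst ℝ ℝ ℝ)
noncomputable def Lt : ℂ →L[ℝ] (ℝ × ℝ →L[ℝ] ℂ) :=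
  ContinuousLinearMap.smulRightL ℝ (ℝ × ℝ) ℂ (ContinuousLinearMap.snd ℝ ℝ ℝ)

lemma rayF_hasFDerivAt {g : ℝ → ℂ} (hg : Continuous g) (w : ℂ) (n : ℕ) (s : ℝ) (p : ℝ × ℝ) :
    HasFDerivAt (fun p : ℝ × ℝ => rayF g w n s p.1 p.2)
      (Lx (Complex.I * rayF g w (n+1) s p.1 p.2) +
        Lt (-rayF g w (n+2) s p.1 p.2 + rayB w n s p.1 * g p.2)) p := by
  have hE : HasFDerivAt (fun p : ℝ × ℝ => Eh g (((s:ℂ) * w)^2) p.2) _ p :=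
    (Eh_hasDerivAt hg (((s:ℂ) * w)^2) p.2).hasFDerivAt.comp p hasFDerivAt_snd
  have hB0 : HasDerivAt (fun x : ℝ => rayB w n s x) (Complex.I * rayB w (n+1) s p.1) p.1 := by
    have h2 : HasDerivAt (fun t : ℝ => Complex.exp ((Complex.I * ((s:ℂ) * w)) * (t:ℂ)))
      (Complex.exp ((Complex.I * ((s:ℂ) * w)) * (p.1:ℂ)) * ((Complex.I * ((s:ℂ) * w)) * 1)) p.1 :=
      (((hasDerivAt_id p.1).ofReal_comp.const_mul _)).cexp
    refine ((h2.const_mul (((s:ℂ) * w)^n)).mul_const w).congr_deriv ?_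
    unfold rayB; ring
  have hB : HasFDerivAt (fun p : ℝ × ℝ => rayB w n s p.1) _ p :=
    hB0.hasFDerivAt.comp p hasFDerivAt_fst
  have h := hB.mul hE
  simp only [rayF_eq]
  refine h.congr_fderiv ?_
  ext <;> simp [Lx, Lt] <;> unfold rayB <;> ring

lemma rayA_hasFDerivAt {g : ℝ → ℂ} (hg : Continuous g) {w : ℂ} (hw : GoodDir w) (n : ℕ)
    (p : ℝ × ℝ) (hp : 0 < p.1) :
    HasFDerivAt (fun p : ℝ × ℝ => rayA g w n p.1 p.2)
      (Lx (Complex.I * rayA g w (n+1) p.1 p.2) +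
        Lt (-rayA g w (n+2) p.1 p.2 +
          (1/(-Complex.I * p.1))^(n+1) * (n.factorial : ℂ) * g p.2)) p := by
  obtain ⟨M, hM0, hM⟩ := exists_bound hg (|p.2| + 1)
  set R := |p.2| + 1 with hR
  have hR0 : 0 ≤ R := by positivity
  set b := w.im * (p.1/2) with hbdef
  have hb : 0 < b := mul_pos hw.im_pos (by linarith)
  have hU : {q : ℝ × ℝ | p.1/2 < q.1 ∧ |q.2| < R} ∈ 𝓝 p := by
    refine IsOpen.mem_nhds ?_ ⟨by linarith, by simp [hR]⟩
    exact (isOpen_lt continuous_const continuous_fst).inter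
      (isOpen_lt continuous_snd.abs continuous_const)
  have i1 := rayF_integrable hg hw (n+1) hp p.2
  have i2 := rayF_integrable hg hw (n+2) hp p.2
  have i3 := rayB_integrable hw n hp
  have iF : Integrable (fun s => Complex.I * rayF g w (n+1) s p.1 p.2)
      (volume.restrict (Ioi (0:ℝ))) := i1.const_mul _
  have iG : Integrable (fun s => -rayF g w (n+2) s p.1 p.2 + rayB w n s p.1 * g p.2)
      (volume.restrict (Ioi (0:ℝ))) := i2.neg.add (i3.mul_const _)
  have key := hasFDerivAt_integral_of_dominated_of_fderiv_le (𝕜 := ℝ)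
    (μ := volume.restrict (Ioi (0:ℝ)))
    (F := fun (q : ℝ × ℝ) s => rayF g w n s q.1 q.2)
    (F' := fun (q : ℝ × ℝ) s => (Lx (Complex.I * rayF g w (n+1) s q.1 q.2) +
        Lt (-rayF g w (n+2) s q.1 q.2 + rayB w n s q.1 * g q.2)))
    (x₀ := p)
    (bound := fun s => ‖Lx‖ * (M * R * (s^(n+1) * Real.exp (-(b * s)))) +
       ‖Lt‖ * (M * R * (s^(n+2) * Real.exp (-(b * s))) + (s^n * Real.exp (-(b * s))) * M))
    hU (Eventually.of_forall fun q => (rayF_cont hg w n q.1 q.2).aestronglyMeasurable)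
    (rayF_integrable hg hw n hp p.2)
    ((Lx.integrable_comp iF).add (Lt.integrable_comp iG)).aestronglyMeasurable
    ?_ ?_ ?_
  · refine key.congr_fderiv ?_
    rw [integral_add (Lx.integrable_comp iF) (Lt.integrable_comp iG),
      Lx.integral_comp_comm iF, Lt.integral_comp_comm iG, integral_const_mul,
      integral_add (f := fun s => -rayF g w (n+2) s p.1 p.2) i2.neg (i3.mul_const _), integral_neg, integral_mul_const,
      rayB_integral hw n hp]
    rfl
  · refine (ae_restrict_mem measurableSet_Ioi).mono fun s hs q hq => ?_
    have hs' : 0 < s := hs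
    have hex : Real.exp (-(w.im * q.1 * s)) ≤ Real.exp (-(b * s)) := by
      apply Real.exp_le_exp.2
      rw [hbdef]
      have : w.im * (p.1/2) ≤ w.im * q.1 := mul_le_mul_of_nonneg_left hq.1.le hw.im_pos.le
      nlinarith [mul_le_mul_of_nonneg_right this hs'.le]
    have hMq : ∀ τ ∈ uIoc (0:ℝ) q.2, ‖g τ‖ ≤ M := fun τ hτ => hM τ (uIoc_sub hq.2.le hτ)
    have hF : ∀ j, ‖rayF g w j s q.1 q.2‖ ≤ M * R * (s^j * Real.exp (-(b * s))) := by
      intro j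
      refine (rayF_norm hw j hs' q.1 q.2 M hMq).trans ?_
      have := hq.2.le
      gcongr
    refine (norm_add_le _ _).trans ?_
    refine add_le_add ((Lx.le_opNorm _).trans ?_) ((Lt.le_opNorm _).trans ?_)
    · refine mul_le_mul_of_nonneg_left ?_ (norm_nonneg _)
      rw [norm_mul, Complex.norm_I, one_mul]
      exact hF _
    · refine mul_le_mul_of_nonneg_left ?_ (norm_nonneg _)
      refine (norm_add_le _ _).trans (add_le_add ?_ ?_)
      · rw [norm_neg]; exact hF _
      · rw [norm_mul, rayB_norm hw n hs']
        have := hM q.2 (abs_le.1 hq.2.le)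
        gcongr
  · exact ((((pe_integrable (n+1) hb).const_mul _).const_mul _).add
      ((((pe_integrable (n+2) hb).const_mul _).add ((pe_integrable n hb).mul_const _)).const_mul _))
  · exact Eventually.of_forall fun s q _ => rayF_hasFDerivAt hg w n s q

noncomputable def Ah (g : ℝ → ℂ) (w v : ℂ) (n : ℕ) (x t : ℝ) : ℂ :=
  rayA g w n x t - rayA g v n x t

lemma Ah_hasFDerivAt {g : ℝ → ℂ} (hg : Continuous g) {w v : ℂ} (hw : GoodDir w) (hv : GoodDir v)
    (n : ℕ) (p : ℝ × ℝ) (hp : 0 < p.1) :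
    HasFDerivAt (fun p : ℝ × ℝ => Ah g w v n p.1 p.2)
      (Lx (Complex.I * Ah g w v (n+1) p.1 p.2) + Lt (-Ah g w v (n+2) p.1 p.2)) p := by
  refine ((rayA_hasFDerivAt hg hw n p hp).sub (rayA_hasFDerivAt hg hv n p hp)).congr_fderiv ?_
  unfold Ah
  rw [add_sub_add_comm, ← map_sub, ← map_sub]
  congr 2 <;> ring

lemma Ah_hasDerivAt_x {g : ℝ → ℂ} (hg : Continuous g) {w v : ℂ} (hw : GoodDir w)
    (hv : GoodDir v) (n : ℕ) {x : ℝ} (hx : 0 < x) (t : ℝ) :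
    HasDerivAt (fun x => Ah g w v n x t) (Complex.I * Ah g w v (n+1) x t) x := by
  have h := (Ah_hasFDerivAt hg hw hv n (x, t) hx).comp_hasDerivAt x
    ((hasDerivAt_id x).prodMk (hasDerivAt_const x t))
  simpa [Lx, Lt, Function.comp_def] using h

lemma Ah_hasDerivAt_t {g : ℝ → ℂ} (hg : Continuous g) {w v : ℂ} (hw : GoodDir w)
    (hv : GoodDir v) (n : ℕ) {x : ℝ} (hx : 0 < x) (t : ℝ) :
    HasDerivAt (fun t => Ah g w v n x t) (-Ah g w v (n+2) x t) t := by
  have h := (Ah_hasFDerivAt hg hw hv n (x, t) hx).comp_hasDerivAt t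
    ((hasDerivAt_const t x).prodMk (hasDerivAt_id t))
  simpa [Lx, Lt, Function.comp_def] using h

lemma Ah_contDiffOn {g : ℝ → ℂ} (hg : Continuous g) {w v : ℂ} (hw : GoodDir w)
    (hv : GoodDir v) (N : ℕ) : ∀ n, ContDiffOn ℝ N (fun p : ℝ × ℝ => Ah g w v n p.1 p.2)
      (Ioi (0:ℝ) ×ˢ univ) := by
  have ho : IsOpen (Ioi (0:ℝ) ×ˢ (univ : Set ℝ)) := isOpen_Ioi.prod isOpen_univ
  induction N with
  | zero =>
    intro n
    rw [Nat.cast_zero, contDiffOn_zero]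
    exact fun p hp => (Ah_hasFDerivAt hg hw hv n p hp.1).continuousAt.continuousWithinAt
  | succ N ih =>
    intro n
    rw [Nat.cast_succ, contDiffOn_succ_iff_fderiv_of_isOpen ho]
    refine ⟨fun p hp =>
      (Ah_hasFDerivAt hg hw hv n p hp.1).differentiableAt.differentiableWithinAt, by simp, ?_⟩
    have h : ContDiffOn ℝ N (fun p : ℝ × ℝ => Lx (Complex.I * Ah g w v (n+1) p.1 p.2) +
        Lt (-Ah g w v (n+2) p.1 p.2)) (Ioi (0:ℝ) ×ˢ univ) :=
      (Lx.contDiff.comp_contDiffOn (contDiffOn_const.mul (ih (n+1)))).add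
        (Lt.contDiff.comp_contDiffOn (ih (n+2)).neg)
    exact h.congr fun p hp => (Ah_hasFDerivAt hg hw hv n p hp.1).fderiv

lemma Ah_zero (g : ℝ → ℂ) (w v : ℂ) (n : ℕ) (x : ℝ) : Ah g w v n x 0 = 0 := by
  simp [Ah, rayA, rayF, Eh]

lemma Ah_decay {g : ℝ → ℂ} (hg : Continuous g) {w v : ℂ} (hw : GoodDir w)
    (hv : GoodDir v) (T : ℝ) (N : ℕ) : ∀ n, ∃ C, 0 ≤ C ∧ ∀ x > 0, ∀ t ∈ Icc 0 T,
      ‖Ah g w v n x t‖ ≤ C * (1/x)^(n+1+2*N) := by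
  induction N with
  | zero =>
    intro n
    obtain ⟨M, hM0, hM⟩ := exists_bound hg T
    have hwp := hw.im_pos
    have hvp := hv.im_pos
    refine ⟨M * |T| * ((1/w.im)^(n+1) * n.factorial) + M * |T| * ((1/v.im)^(n+1) * n.factorial),
      by positivity, fun x hx t ht => ?_⟩
    have hx' : 0 < x := hx
    have htT : |t| ≤ |T| := by
      rw [abs_of_nonneg ht.1]; exact ht.2.trans (le_abs_self T)
    have hMt : ∀ τ ∈ uIoc (0:ℝ) t, ‖g τ‖ ≤ M := fun τ hτ => hM τ
      (uIoc_sub (by rw [abs_of_nonneg ht.1]; exact ht.2) hτ)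
    have aux : ∀ u : ℂ, GoodDir u → ‖rayA g u n x t‖ ≤
        M * |T| * ((1/u.im)^(n+1) * n.factorial) * (1/x)^(n+1) := by
      intro u hu
      have hup := hu.im_pos
      refine (rayA_bound hu n hx' t M hMt).trans ?_
      have e : (1/(u.im * x))^(n+1) = (1/u.im)^(n+1) * (1/x)^(n+1) := by
        rw [← mul_pow]; congr 1; field_simp
      rw [e]
      calc _ ≤ M * |T| * ((1/u.im)^(n+1) * (1/x)^(n+1) * n.factorial) := by gcongr
        _ = _ := by ring
    unfold Ah
    refine (norm_sub_le _ _).trans ?_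
    rw [mul_zero, add_zero, add_mul]
    exact add_le_add (aux w hw) (aux v hv)
  | succ N ih =>
    intro n
    obtain ⟨C, hC0, hC⟩ := ih (n+2)
    refine ⟨C * |T|, by positivity, fun x hx t ht => ?_⟩
    have hx' : 0 < x := hx
    have h := (convex_Icc (0:ℝ) T).norm_image_sub_le_of_norm_hasDerivWithin_le
      (f := fun t => Ah g w v n x t) (f' := fun t => -Ah g w v (n+2) x t)
      (C := C * (1/x)^(n+2+1+2*N)) (x := 0) (y := t)
      (fun r _ => (Ah_hasDerivAt_t hg hw hv n hx' r).hasDerivWithinAt)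
      (fun r hr => by rw [norm_neg]; exact hC x hx r hr)
      ⟨le_rfl, ht.1.trans ht.2⟩ ht
    simp only [Ah_zero, sub_zero] at h
    refine h.trans ?_
    have htT : ‖t‖ ≤ |T| := by
      rw [Real.norm_eq_abs, abs_of_nonneg ht.1]; exact ht.2.trans (le_abs_self T)
    rw [show n+1+2*(N+1) = n+2+1+2*N by ring]
    calc _ ≤ C * (1/x)^(n+2+1+2*N) * |T| := by gcongr
      _ = _ := by ring

lemma goodDir1 : GoodDir (Complex.exp (Complex.I * (Real.pi:ℂ) / 4)) := by
  have e : Complex.I * (Real.pi:ℂ) / 4 = ((Real.pi/4 : ℝ):ℂ) * Complex.I := by push_cast; ring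
  refine ⟨?_, ?_, ?_⟩
  · rw [e, Complex.norm_exp_ofReal_mul_I]
  · rw [← Complex.exp_nat_mul, show ((2:ℕ):ℂ) * (Complex.I * (Real.pi:ℂ) / 4)
      = ((Real.pi/2 : ℝ):ℂ) * Complex.I by push_cast; ring, Complex.exp_ofReal_mul_I_re]
    simp
  · rw [e, Complex.exp_ofReal_mul_I_im]
    exact Real.sin_pos_of_pos_of_lt_pi (by positivity) (by linarith [Real.pi_pos])

lemma goodDir2 : GoodDir (Complex.exp (3 * Complex.I * (Real.pi:ℂ) / 4)) := by
  have e : 3 * Complex.I * (Real.pi:ℂ) / 4 = ((3*Real.pi/4 : ℝ):ℂ) * Complex.I := by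
    push_cast; ring
  refine ⟨?_, ?_, ?_⟩
  · rw [e, Complex.norm_exp_ofReal_mul_I]
  · rw [← Complex.exp_nat_mul, show ((2:ℕ):ℂ) * (3 * Complex.I * (Real.pi:ℂ) / 4)
      = ((Real.pi/2 + Real.pi : ℝ):ℂ) * Complex.I by push_cast; ring, Complex.exp_ofReal_mul_I_re,
      Real.cos_add_pi]
    simp
  · rw [e, Complex.exp_ofReal_mul_I_im]
    exact Real.sin_pos_of_pos_of_lt_pi (by positivity) (by linarith [Real.pi_pos])

lemma Fgamma_eq (g₀ : ℝ → ℂ) (x : ℝ) {t : ℝ} (ht : 0 ≤ t) (s : ℝ) (w : ℂ) :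
    FgammaHeat g₀ x t ((s:ℂ) * w) * w = rayF (fun τ => g₀ (max 0 τ)) w 1 s x t := by
  have : gTildeHeat g₀ ((s:ℂ) * w) t
      = ∫ τ in (0:ℝ)..t, Complex.exp (((s:ℂ) * w)^2 * (τ:ℂ)) * g₀ (max 0 τ) := by
    unfold gTildeHeat
    refine intervalIntegral.integral_congr fun τ hτ => ?_
    rw [uIcc_of_le ht] at hτ
    simp only [max_eq_right hτ.1]
  unfold FgammaHeat rayF Eh
  rw [this, sub_eq_add_neg, Complex.exp_add]
  ring

lemma Hheat_eq (g₀ : ℝ → ℂ) (x : ℝ) {t : ℝ} (ht : 0 ≤ t) :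
    Hheat g₀ x t = Ah (fun τ => g₀ (max 0 τ)) (Complex.exp (Complex.I * (Real.pi:ℂ) / 4))
      (Complex.exp (3 * Complex.I * (Real.pi:ℂ) / 4)) 1 x t := by
  unfold Hheat Ah rayA
  simp only [Fgamma_eq g₀ x ht]

lemma Ah_iter_t {g : ℝ → ℂ} (hg : Continuous g) {w v : ℂ} (hw : GoodDir w)
    (hv : GoodDir v) {x : ℝ} (hx : 0 < x) (m : ℕ) : ∀ n,
    iteratedDeriv m (fun t => Ah g w v n x t) = fun t => (-1)^m * Ah g w v (n+2*m) x t := by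
  induction m with
  | zero => intro n; simp
  | succ m ih =>
    intro n
    rw [iteratedDeriv_succ, ih]
    ext t
    rw [((Ah_hasDerivAt_t hg hw hv (n+2*m) hx t).const_mul ((-1:ℂ)^m)).deriv]
    rw [show n + 2*(m+1) = n+2*m+2 by ring]
    ring

lemma Ah_iter_x {g : ℝ → ℂ} (hg : Continuous g) {w v : ℂ} (hw : GoodDir w)
    (hv : GoodDir v) (t : ℝ) (c : ℂ) (n k : ℕ) : ∀ x > 0,
    iteratedDeriv k (fun x => c * Ah g w v n x t) x = c * Complex.I^k * Ah g w v (n+k) x t := by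
  induction k with
  | zero => intro n; simp
  | succ k ih =>
    intro x hx
    have he : iteratedDeriv k (fun x => c * Ah g w v n x t) =ᶠ[𝓝 x]
        fun x => c * Complex.I^k * Ah g w v (n+k) x t :=
      by
        filter_upwards [Ioi_mem_nhds hx] with y hy using ih y hy
    rw [iteratedDeriv_succ, he.deriv_eq,
      ((Ah_hasDerivAt_x hg hw hv (n+k) hx t).const_mul (c * Complex.I^k)).deriv]
    rw [show n + (k+1) = n+k+1 by ring]
    ring

theorem stmt19 (g₀ : ℝ → ℂ) (hg : ContDiffOn ℝ (⊤:ℕ∞) g₀ (Ici (0:ℝ))) :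
    ContDiffOn ℝ (⊤:ℕ∞) (fun p : ℝ × ℝ => Hheat g₀ p.1 p.2) (Ioi (0:ℝ) ×ˢ Ioi (0:ℝ)) ∧
    ∀ k m l : ℕ, ∀ T₀ > (0:ℝ), ∀ δ > (0:ℝ), ∃ X : ℝ, ∀ x ≥ X, ∀ t ∈ Ioc (0:ℝ) T₀,
      x ^ l *
        ‖iteratedDeriv k (fun y => iteratedDeriv m (fun s => Hheat g₀ y s) t) x‖ < δ := by
  have hc : Continuous (fun τ => g₀ (max 0 τ)) :=
    hg.continuousOn.comp_continuous (by fun_prop) fun τ => mem_Ici.2 (le_max_left _ _)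
  refine ⟨?_, ?_⟩
  · rw [contDiffOn_infty]
    intro N
    refine ((Ah_contDiffOn hc goodDir1 goodDir2 N 1).mono
      (prod_mono le_rfl (subset_univ _))).congr fun p hp => ?_
    exact Hheat_eq g₀ p.1 (le_of_lt hp.2)
  · intro k m l T hT δ hδ
    obtain ⟨C, hC0, hC⟩ := Ah_decay hc goodDir1 goodDir2 T l (1+2*m+k)
    refine ⟨max 1 (C/δ + 1), fun x hx t ht => ?_⟩
    have hx1 : 1 ≤ x := (le_max_left _ _).trans hx
    have hx2 : C/δ + 1 ≤ x := (le_max_right _ _).trans hx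
    have hx0 : 0 < x := by linarith
    have he : (fun y => iteratedDeriv m (fun s => Hheat g₀ y s) t) =ᶠ[𝓝 x]
        fun y => (-1)^m * Ah (fun τ => g₀ (max 0 τ))
          (Complex.exp (Complex.I * (Real.pi:ℂ) / 4))
          (Complex.exp (3 * Complex.I * (Real.pi:ℂ) / 4)) (1+2*m) y t := by
      filter_upwards [Ioi_mem_nhds hx0] with y hy
      have h1 : (fun s => Hheat g₀ y s) =ᶠ[𝓝 t] fun s => Ah (fun τ => g₀ (max 0 τ))
          (Complex.exp (Complex.I * (Real.pi:ℂ) / 4))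
          (Complex.exp (3 * Complex.I * (Real.pi:ℂ) / 4)) 1 y s :=
        by
        filter_upwards [Ioi_mem_nhds ht.1] with s hs using Hheat_eq g₀ y (le_of_lt hs)
      exact (h1.iteratedDeriv_eq m).trans
        (congrFun (Ah_iter_t hc goodDir1 goodDir2 hy m 1) t)
    rw [he.iteratedDeriv_eq k, Ah_iter_x hc goodDir1 goodDir2 t _ _ k x hx0, norm_mul]
    have hn : ‖((-1:ℂ)^m * Complex.I^k)‖ = 1 := by simp
    rw [hn, one_mul]
    have h1x : 1/x ≤ 1 := by rw [div_le_one hx0]; exact hx1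
    have h1x0 : 0 ≤ 1/x := by positivity
    calc _ ≤ x^l * (C * (1/x)^(1+2*m+k+1+2*l)) :=
          mul_le_mul_of_nonneg_left (hC x hx0 t ⟨ht.1.le, ht.2⟩) (by positivity)
      _ ≤ x^l * (C * (1/x)^(l+1)) := by
          gcongr x^l * (C * ?_)
          exact pow_le_pow_of_le_one h1x0 h1x (by omega)
      _ = C / x := by
          rw [pow_succ, one_div, inv_pow]; field_simp
      _ < δ := by
          rw [div_lt_iff₀ hx0]
          have : C / δ < x := by linarith
          rw [div_lt_iff₀ hδ] at this
          linarith
end
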